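/- For every Schwartz function F on ℝ³×ℝ³ that is SO(3)-invariant, there exists a Schwartz function f ∈ 𝒮(ℝ³) such that: (a) for all λ>0, l∈ℕ, r∈ℝ, f(λ(2l+1)+r², λ², λr) = ∫_{ℝ³×ℝ³} F(x,y)·conj(φ_{λ,l,r}(x,y)) dx dy; and (b) for all R≥0, f(R², 0, 0) = ∫_{ℝ³×ℝ³} F(x,y)·φ_{0,R}(x,y) dx dy. (This is the existence part of the main theorem: the Gelfand transform of any Schwartz SO(3)-invariant function on the free two-step nilpotent group N_{3,2} admits a Schwartz extension to ℝ³.) -/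

import Mathlib

open MeasureTheory Complex Matrix

noncomputable section

abbrev V3 := Fin 3 → ℝ
abbrev Mat3 := Matrix (Fin 3) (Fin 3) ℝ

instance : MeasurableSpace Mat3 := (inferInstance : MeasurableSpace (Fin 3 → Fin 3 → ℝ))

/-- The set of special orthogonal 3×3 real matrices. -/
def SO3 : Set Mat3 := {A | A * A.transpose = 1 ∧ A.det = 1}

/-- `SO(3)`-invariance of a function on `ℝ³ × ℝ³` (simultaneous action on both factors). -/
def Inv3 (F : V3 × V3 → ℂ) : Prop :=
  ∀ k ∈ SO3, ∀ x y : V3, F (k.mulVec x, k.mulVec y) = F (x, y)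

/-- `μ` is the Haar probability measure of `SO(3)`, viewed as a measure on the space of
matrices: a left-invariant Borel probability measure concentrated on `SO3`.  (On the
compact metrizable group `SO(3)` such a measure is unique.) -/
def IsHaarSO3 (μ : Measure Mat3) : Prop :=
  IsProbabilityMeasure μ ∧ μ SO3ᶜ = 0 ∧ ∀ k ∈ SO3, μ.map (fun A => k * A) = μ

/-- The Laguerre function of order 0: `𝓛_l(u) = (1/l!) e^{u/2} (d/du)^l (u^l e^{-u})`. -/
def lag (l : ℕ) (u : ℝ) : ℝ :=
  (l.factorial : ℝ)⁻¹ * Real.exp (u / 2) * deriv^[l] (fun v : ℝ => v ^ l * Real.exp (-v)) u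

/-- The regular bounded spherical functions `φ_{λ,l,r}` of `(SO(3) ⋉ N_{3,2}, SO(3))`:
`φ_{λ,l,r}(x,y) = ∫_{SO(3)} e^{-iλ(ky)₃} 𝓛_l((λ/2)((kx)₁² + (kx)₂²)) e^{-ir(kx)₃} dk`. -/
def sph (μ : Measure Mat3) (lam : ℝ) (l : ℕ) (r : ℝ) (x y : V3) : ℂ :=
  ∫ k, Complex.exp (-(Complex.I * lam * ((k.mulVec y) 2))) *
      (lag l (lam / 2 * (((k.mulVec x) 0) ^ 2 + ((k.mulVec x) 1) ^ 2)) : ℝ) *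
      Complex.exp (-(Complex.I * r * ((k.mulVec x) 2))) ∂μ

/-- The Euclidean norm on `ℝ³`. -/
def nrm3 (x : V3) : ℝ := Real.sqrt (x 0 ^ 2 + x 1 ^ 2 + x 2 ^ 2)

/-- The singular bounded spherical functions `φ_{0,R}(x,y) = sin(R|x|)/(R|x|)`,
interpreted as `1` when `R|x| = 0`. -/
def sph0 (R : ℝ) (x : V3) : ℝ :=
  if R * nrm3 x = 0 then 1 else Real.sin (R * nrm3 x) / (R * nrm3 x)


set_option linter.all false

lemma schwartz_of_closed {E : Type*} [NormedAddCommGroup E] [NormedSpace ℝ E]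
    [FiniteDimensional ℝ E] (C : Set (E → ℂ))
    (hd : ∀ f ∈ C, Differentiable ℝ f)
    (hder : ∀ f ∈ C, ∀ v, (fun x => fderiv ℝ f x v) ∈ C)
    (hmul : ∀ f ∈ C, ∀ L : E →L[ℝ] ℝ, (fun x => (L x : ℂ) * f x) ∈ C)
    (hb : ∀ f ∈ C, ∃ K : ℝ, ∀ x, ‖f x‖ ≤ K) (f : E → ℂ) (hf : f ∈ C) :
    ∃ g : SchwartzMap E ℂ, ∀ x, g x = f x := by
  classical
  let b := Module.finBasis ℝ E
  let l : Fin (Module.finrank ℝ E) → E →L[ℝ] ℝ := fun i => LinearMap.toContinuousLinearMap (b.coord i)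
  have hx : ∀ x : E, x = ∑ i, l i x • b i := fun x => (b.sum_repr x).symm
  have hcd : ∀ n : ℕ, ∀ f ∈ C, ContDiff ℝ n f := by
    intro n
    induction n with
    | zero => intro f hf; exact contDiff_zero.2 (hd f hf).continuous
    | succ n ih =>
      intro f hf
      have : ((n + 1 : ℕ) : WithTop ℕ∞) = (n : WithTop ℕ∞) + 1 := by norm_cast
      rw [this, contDiff_succ_iff_fderiv]
      refine ⟨hd f hf, by simp, ?_⟩
      rw [contDiff_clm_apply_iff]
      intro y
      exact ih _ (hder f hf y)
  have hk : ∀ k : ℕ, ∀ f ∈ C, ∃ K : ℝ, ∀ x, ‖x‖ ^ k * ‖f x‖ ≤ K := by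
    intro k
    induction k with
    | zero => intro f hf; simpa using hb f hf
    | succ k ih =>
      intro f hf
      choose K hK using fun i => ih _ (hmul f hf (l i))
      refine ⟨∑ i, ‖b i‖ * K i, fun x => ?_⟩
      have h1 : ‖x‖ ≤ ∑ i, ‖l i x‖ * ‖b i‖ := by
        conv_lhs => rw [hx x]
        refine (norm_sum_le _ _).trans (Finset.sum_le_sum fun i _ => ?_)
        rw [norm_smul]
      calc ‖x‖ ^ (k+1) * ‖f x‖ = ‖x‖ * (‖x‖ ^ k * ‖f x‖) := by ring
        _ ≤ (∑ i, ‖l i x‖ * ‖b i‖) * (‖x‖ ^ k * ‖f x‖) := by gcongr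
        _ = ∑ i, ‖b i‖ * (‖x‖ ^ k * ‖(l i x : ℂ) * f x‖) := by
            rw [Finset.sum_mul]
            refine Finset.sum_congr rfl fun i _ => ?_
            rw [norm_mul, Complex.norm_real]; ring
        _ ≤ _ := Finset.sum_le_sum fun i _ => by gcongr; exact hK i x
  have hn : ∀ n : ℕ, ∀ k : ℕ, ∀ f ∈ C, ∃ K : ℝ, ∀ x, ‖x‖ ^ k * ‖iteratedFDeriv ℝ n f x‖ ≤ K := by
    intro n
    induction n with
    | zero => intro k f hf; simpa using hk k f hf
    | succ n ih =>
      intro k f hf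
      choose K hK using fun i => ih k _ (hder f hf (b i))
      let S : Fin (Module.finrank ℝ E) → ℂ →L[ℝ] (E →L[ℝ] ℂ) := fun i =>
        ContinuousLinearMap.smulRightL ℝ E ℂ (l i)
      have hfd : fderiv ℝ f = fun x => ∑ i, (S i ∘ (fun x => fderiv ℝ f x (b i))) x := by
        ext x v
        conv_lhs => rw [hx v]
        simp [S, map_sum]
      refine ⟨∑ i, ‖S i‖ * K i, fun x => ?_⟩
      have hcd' : ∀ i, ContDiff ℝ n (fun x => fderiv ℝ f x (b i)) := fun i => hcd n _ (hder f hf (b i))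
      rw [← norm_iteratedFDeriv_fderiv, hfd, iteratedFDeriv_sum
        (fun i _ => (S i).contDiff.comp (hcd' i))]
      rw [Finset.sum_apply]
      calc _ ≤ ‖x‖ ^ k * ∑ i, ‖iteratedFDeriv ℝ n (S i ∘ (fun x => fderiv ℝ f x (b i))) x‖ := by
            gcongr; exact norm_sum_le _ _
        _ ≤ ‖x‖ ^ k * ∑ i, ‖S i‖ * ‖iteratedFDeriv ℝ n (fun x => fderiv ℝ f x (b i)) x‖ := by
            gcongr with i
            exact (S i).norm_iteratedFDeriv_comp_left (hcd' i).contDiffAt le_rfl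
        _ = ∑ i, ‖S i‖ * (‖x‖ ^ k * ‖iteratedFDeriv ℝ n (fun x => fderiv ℝ f x (b i)) x‖) := by
            rw [Finset.mul_sum]; exact Finset.sum_congr rfl fun i _ => by ring
        _ ≤ _ := Finset.sum_le_sum fun i _ => by gcongr; exact hK i x
  refine ⟨⟨f, ?_, fun k n => hn n k f hf⟩, fun x => rfl⟩
  exact contDiff_infty.2 fun n => hcd n f hf

lemma dom_aux {V P G H : Type*} [NormedAddCommGroup V] [NormedSpace ℝ V]
    [MeasurableSpace V] [BorelSpace V] (ν : Measure V) [ν.HasTemperateGrowth]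
    [NormedAddCommGroup P] [NormedSpace ℝ P] [NormedAddCommGroup G] [NormedSpace ℝ G]
    [NormedAddCommGroup H] [NormedSpace ℝ H]
    (A : SchwartzMap (V × P) G) (T : V × P → H) (hT : T.HasTemperateGrowth) :
    ∃ g : V → ℝ, Integrable g ν ∧ (∀ v, 0 ≤ g v) ∧ ∀ v p, ‖A (v, p)‖ * ‖T (v, p)‖ ≤ g v := by
  obtain ⟨k, C, hC⟩ := hT.2 0
  simp only [norm_iteratedFDeriv_zero] at hC
  have hC0 : 0 ≤ C := by have := (norm_nonneg _).trans (hC 0); simpa using this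
  let n := ν.integrablePower
  let K := 2 ^ (k + n) * ((Finset.Iic (k + n, 0)).sup fun m => SchwartzMap.seminorm ℝ m.1 m.2) A
  have hA : ∀ x, (1 + ‖x‖) ^ (k + n) * ‖A x‖ ≤ K := by
    intro x
    have := SchwartzMap.one_add_le_sup_seminorm_apply (𝕜 := ℝ) (m := (k + n, 0)) (k := k + n)
      (n := 0) le_rfl le_rfl A x
    simpa using this
  have hK0 : 0 ≤ K := le_trans (by positivity) (hA 0)
  refine ⟨fun v => C * K * (1 + ‖v‖) ^ (-(n : ℝ)),
    (Measure.integrable_pow_neg_integrablePower ν).const_mul _, fun v => by positivity, fun v p => ?_⟩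
  have h1 : (0:ℝ) < 1 + ‖v‖ := by positivity
  show ‖A (v, p)‖ * ‖T (v, p)‖ ≤ C * K * (1 + ‖v‖) ^ (-(n:ℝ))
  rw [Real.rpow_neg h1.le, Real.rpow_natCast, ← div_eq_mul_inv, le_div_iff₀ (by positivity)]
  have hv : ‖v‖ ≤ ‖(v, p)‖ := norm_fst_le (v, p)
  calc ‖A (v, p)‖ * ‖T (v, p)‖ * (1 + ‖v‖) ^ n
      ≤ ‖A (v, p)‖ * (C * (1 + ‖(v, p)‖) ^ k) * (1 + ‖(v, p)‖) ^ n := by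
        gcongr
        exact hC _
    _ = C * ((1 + ‖(v, p)‖) ^ (k + n) * ‖A (v, p)‖) := by rw [pow_add]; ring
    _ ≤ C * K := by gcongr; exact hA _

lemma tg_fderiv {E G : Type*} [NormedAddCommGroup E] [NormedSpace ℝ E] [NormedAddCommGroup G]
    [NormedSpace ℝ G] {f : E → G} (hf : f.HasTemperateGrowth) :
    (fderiv ℝ f).HasTemperateGrowth := by
  refine ⟨hf.1.fderiv_right (by simp), fun n => ?_⟩
  obtain ⟨k, C, h⟩ := hf.2 (n+1)
  exact ⟨k, C, fun x => by rw [norm_iteratedFDeriv_fderiv]; exact h x⟩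

section osc
variable {V Z P : Type*} [NormedAddCommGroup V] [NormedSpace ℝ V] [FiniteDimensional ℝ V]
  [MeasurableSpace V] [BorelSpace V] 
  [NormedAddCommGroup Z] [NormedSpace ℝ Z] [FiniteDimensional ℝ Z]
  [NormedAddCommGroup P] [NormedSpace ℝ P] [FiniteDimensional ℝ P]

def osc (ν : Measure V) (Θ : V × P → (Z →L[ℝ] ℝ)) (A : V × P → ℂ) (q : Z × P) : ℂ :=
  ∫ v, A (v, q.2) * cexp (-(I * (Θ (v, q.2) q.1 : ℝ))) ∂ν

lemma norm_osc_exp (x : ℝ) : ‖cexp (-(I * x))‖ = 1 := by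
  rw [show -(I * (x:ℂ)) = ((-x : ℝ) : ℂ) * I by push_cast; ring, Complex.norm_exp_ofReal_mul_I]

lemma osc_integrable (ν : Measure V) [ν.HasTemperateGrowth] (Θ : V × P → (Z →L[ℝ] ℝ))
    (hΘ : Continuous Θ)
    (A : SchwartzMap (V × P) ℂ) (q : Z × P) : 
    Integrable (fun v => A (v, q.2) * cexp (-(I * (Θ (v, q.2) q.1 : ℝ)))) ν := by
  haveI : ProperSpace V := FiniteDimensional.proper_real V
  obtain ⟨g, hg, hg0, hb⟩ := dom_aux ν A (fun _ => (1:ℝ)) (Function.HasTemperateGrowth.const _)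
  refine hg.mono' ?_ (Filter.Eventually.of_forall fun v => ?_)
  · apply Continuous.aestronglyMeasurable
    have := A.continuous
    fun_prop
  · rw [norm_mul, norm_osc_exp]; simpa using hb v q.2

lemma osc_add (ν : Measure V) [ν.HasTemperateGrowth] (Θ : V × P → (Z →L[ℝ] ℝ))
    (hΘ : Continuous Θ)
    (A B : SchwartzMap (V × P) ℂ) (q : Z × P) : 
    osc ν Θ (A + B : SchwartzMap (V × P) ℂ) q = osc ν Θ A q + osc ν Θ B q := by
  unfold osc
  rw [← integral_add (osc_integrable ν Θ hΘ A q) (osc_integrable ν Θ hΘ B q)]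
  simp [add_mul]

def oscD (Θ : V × P → (Z →L[ℝ] ℝ)) (A : V × P → ℂ) (q : Z × P) (v : V) : Z × P →L[ℝ] ℂ :=
  cexp (-(I * (Θ (v, q.2) q.1 : ℝ))) • ((fderiv ℝ A (v, q.2)).comp 
    ((ContinuousLinearMap.inr ℝ V P).comp (ContinuousLinearMap.snd ℝ Z P)))
  + (A (v, q.2) * (cexp (-(I * (Θ (v, q.2) q.1 : ℝ))) * (-I))) • (ofRealCLM.comp 
     (((fderiv ℝ Θ (v, q.2)).comp 
    ((ContinuousLinearMap.inr ℝ V P).comp (ContinuousLinearMap.snd ℝ Z P))).flip q.1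
     + (Θ (v, q.2)).comp (ContinuousLinearMap.fst ℝ Z P)))

lemma oscD_apply (Θ : V × P → (Z →L[ℝ] ℝ)) (A : V × P → ℂ) (q : Z × P) (v : V) (w : Z × P) :
   oscD Θ A q v w = fderiv ℝ A (v, q.2) (0, w.2) * cexp (-(I * (Θ (v, q.2) q.1 : ℝ))) +
    A (v, q.2) * cexp (-(I * (Θ (v, q.2) q.1 : ℝ))) * (-I) * 
      ((fderiv ℝ Θ (v, q.2) (0, w.2) q.1 + Θ (v, q.2) w.1 : ℝ) : ℂ) := by
  simp [oscD]; ring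

lemma osc_hasFDerivAt_aux (Θ : V × P → (Z →L[ℝ] ℝ)) (A : V × P → ℂ) (hΘ : Differentiable ℝ Θ)
    (hA : Differentiable ℝ A) (q : Z × P) (v : V) :
    HasFDerivAt (fun q : Z × P => A (v, q.2) * cexp (-(I * (Θ (v, q.2) q.1 : ℝ))))
      (oscD Θ A q v) q := by
  have h0 : HasFDerivAt (fun q : Z × P => ((v, q.2) : V × P)) 
    ((ContinuousLinearMap.inr ℝ V P).comp (ContinuousLinearMap.snd ℝ Z P)) q := by
    have := (hasFDerivAt_const (𝕜 := ℝ) v q).prodMk (hasFDerivAt_snd (𝕜 := ℝ) (p := q))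
    refine this.congr_fderiv ?_
    ext w <;> simp
  have h1 : HasFDerivAt (fun q : Z × P => A (v, q.2)) _ q :=
    HasFDerivAt.comp q (hA (v, q.2)).hasFDerivAt h0
  have h2 : HasFDerivAt (fun q : Z × P => Θ (v, q.2)) _ q :=
    HasFDerivAt.comp q (hΘ (v, q.2)).hasFDerivAt h0
  have h3 := h2.clm_apply (hasFDerivAt_fst (𝕜 := ℝ) (p := q))
  have h4 : HasFDerivAt (fun q : Z × P => ((Θ (v, q.2) q.1 : ℝ) : ℂ)) _ q :=
    HasFDerivAt.comp q (ofRealCLM.hasFDerivAt) h3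
  have h5 := h1.mul ((h4.const_mul I).neg.cexp)
  refine h5.congr_fderiv ?_
  ext w <;> simp [oscD] <;> ring

lemma oscD_bound (Θ : V × P → (Z →L[ℝ] ℝ)) (A : V × P → ℂ) (q : Z × P) (v : V) :
    ‖oscD Θ A q v‖ ≤ ‖fderiv ℝ A (v, q.2)‖ + (‖A (v, q.2)‖ * ‖fderiv ℝ Θ (v, q.2)‖ * ‖q‖ + 
       ‖A (v, q.2)‖ * ‖Θ (v, q.2)‖) := by
  refine ContinuousLinearMap.opNorm_le_bound _ (by positivity) fun w => ?_
  rw [oscD_apply]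
  refine (norm_add_le _ _).trans ?_
  simp only [norm_mul, norm_osc_exp, norm_neg, Complex.norm_I, mul_one, Complex.norm_real]
  have hw1 : ‖w.1‖ ≤ ‖w‖ := norm_fst_le w
  have hw2 : ‖((0, w.2) : V × P)‖ ≤ ‖w‖ := by 
    rw [Prod.norm_mk]; simpa using norm_snd_le w
  have e1 : ‖fderiv ℝ A (v, q.2) (0, w.2)‖ ≤ ‖fderiv ℝ A (v, q.2)‖ * ‖w‖ :=
    (ContinuousLinearMap.le_opNorm _ _).trans (by gcongr)
  have e2 : ‖fderiv ℝ Θ (v, q.2) (0, w.2) q.1‖ ≤ ‖fderiv ℝ Θ (v, q.2)‖ * ‖w‖ * ‖q‖ := by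
    refine (ContinuousLinearMap.le_opNorm _ _).trans ?_
    gcongr
    · exact (ContinuousLinearMap.le_opNorm _ _).trans (by gcongr)
    · exact norm_fst_le q
  have e3 : ‖Θ (v, q.2) w.1‖ ≤ ‖Θ (v, q.2)‖ * ‖w‖ := 
    (ContinuousLinearMap.le_opNorm _ _).trans (by gcongr)
  calc _ ≤ ‖fderiv ℝ A (v, q.2)‖ * ‖w‖ + ‖A (v, q.2)‖ * 
      (‖fderiv ℝ Θ (v, q.2)‖ * ‖w‖ * ‖q‖ + ‖Θ (v, q.2)‖ * ‖w‖) := by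
        gcongr
        exact (norm_add_le _ _).trans (add_le_add e2 e3)
    _ = _ := by ring

lemma osc_hasFDerivAt (ν : Measure V) [ν.HasTemperateGrowth] (Θ : V × P → (Z →L[ℝ] ℝ)) 
    (hΘ : Θ.HasTemperateGrowth) (A : SchwartzMap (V × P) ℂ) (q : Z × P) :
    Integrable (oscD Θ A q) ν ∧ HasFDerivAt (osc ν Θ A) (∫ v, oscD Θ A q v ∂ν) q := by
  haveI : ProperSpace V := FiniteDimensional.proper_real V
  have cΘ : Continuous Θ := hΘ.1.continuous
  have cΘ' : Continuous (fderiv ℝ Θ) := hΘ.1.continuous_fderiv (by simp)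
  have cA := A.continuous
  have cA' : Continuous (fderiv ℝ A) := (A.smooth 1).continuous_fderiv (by simp)
  obtain ⟨g1, hg1, hg10, hb1⟩ := dom_aux ν (SchwartzMap.fderivCLM ℝ _ _ A) (fun _ => (1:ℝ))
    (Function.HasTemperateGrowth.const _)
  obtain ⟨g2, hg2, hg20, hb2⟩ := dom_aux ν A _ (tg_fderiv hΘ)
  obtain ⟨g3, hg3, hg30, hb3⟩ := dom_aux ν A _ hΘ
  have hcont : Continuous (oscD Θ A q) := by
    rw [continuous_clm_apply]
    intro w
    simp only [oscD_apply]
    fun_prop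
  have hbd : ∀ v, ∀ x ∈ Metric.ball q 1, ‖oscD Θ A x v‖ ≤ 
      g1 v + (g2 v * (‖q‖ + 1) + g3 v) := by
    intro v x hx
    have hx' : ‖x‖ ≤ ‖q‖ + 1 := by
      have := norm_sub_norm_le x q
      rw [Metric.mem_ball, dist_eq_norm] at hx; linarith
    refine (oscD_bound Θ A x v).trans ?_
    have a1 : ‖fderiv ℝ A (v, x.2)‖ ≤ g1 v := by simpa using hb1 v x.2
    have a2 := hb2 v x.2
    have a3 := hb3 v x.2
    have := hg20 v
    gcongr
  have hint : Integrable (fun v => g1 v + (g2 v * (‖q‖ + 1) + g3 v)) ν := 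
    hg1.add ((hg2.mul_const _).add hg3)
  refine ⟨hint.mono' hcont.aestronglyMeasurable (Filter.Eventually.of_forall fun v =>
    hbd v q (Metric.mem_ball_self one_pos)), ?_⟩
  refine hasFDerivAt_integral_of_dominated_of_fderiv_le 
    (bound := fun v => g1 v + (g2 v * (‖q‖ + 1) + g3 v)) (Metric.ball_mem_nhds q one_pos)
    (Filter.Eventually.of_forall fun x => (osc_integrable ν Θ cΘ A x).1)
    (osc_integrable ν Θ cΘ A q) hcont.aestronglyMeasurable
    (Filter.Eventually.of_forall hbd) hint (Filter.Eventually.of_forall fun v x _ => 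
     osc_hasFDerivAt_aux Θ A (hΘ.1.differentiable (by simp)) A.differentiable x v)

def smulS {E : Type*} [NormedAddCommGroup E] [NormedSpace ℝ E] (g : E → ℂ)
   (A : SchwartzMap E ℂ) : SchwartzMap E ℂ := SchwartzMap.smulLeftCLM ℂ g A

lemma smulS_apply {E : Type*} [NormedAddCommGroup E] [NormedSpace ℝ E] {g : E → ℂ}
   (hg : g.HasTemperateGrowth) (A : SchwartzMap E ℂ) (x : E) : smulS g A x = g x * A x := by
  rw [smulS, SchwartzMap.smulLeftCLM_apply_apply hg, smul_eq_mul]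

lemma tg_ofReal {E : Type*} [NormedAddCommGroup E] [NormedSpace ℝ E] {g : E → ℝ}
   (hg : g.HasTemperateGrowth) : (fun x => (g x : ℂ)).HasTemperateGrowth :=
  (ofRealCLM.hasTemperateGrowth).comp hg

lemma tg_clm {E G : Type*} [NormedAddCommGroup E] [NormedSpace ℝ E] [NormedAddCommGroup G] 
   [NormedSpace ℝ G] {g : E → G} (L : G →L[ℝ] ℝ)
   (hg : g.HasTemperateGrowth) : (fun x => L (g x)).HasTemperateGrowth :=
  (L.hasTemperateGrowth).comp hg

theorem osc_schwartz (ν : Measure V) [ν.HasTemperateGrowth] (Θ : V × P → (Z →L[ℝ] ℝ)) 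
    (hΘ : Θ.HasTemperateGrowth)
    (hM : ∀ (A : SchwartzMap (V × P) ℂ) (L : Z →L[ℝ] ℝ), ∃ A' : SchwartzMap (V × P) ℂ, 
      ∀ q : Z × P, (L q.1 : ℂ) * osc ν Θ A q = osc ν Θ A' q) 
    (A : SchwartzMap (V × P) ℂ) : ∃ g : SchwartzMap (Z × P) ℂ, ∀ x, g x = osc ν Θ A x := by
  classical
  have cΘ : Continuous Θ := hΘ.1.continuous
  have hsum : ∀ {ι : Type} (s : Finset ι) (B : ι → SchwartzMap (V × P) ℂ) (q : Z × P),
      osc ν Θ (∑ i ∈ s, B i : SchwartzMap (V × P) ℂ) q = ∑ i ∈ s, osc ν Θ (B i) q := by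
    intro ι s B q
    induction s using Finset.induction_on with
    | empty => simp [osc]
    | insert a s ha ih => rw [Finset.sum_insert ha, Finset.sum_insert ha, osc_add ν Θ cΘ, ih]
  refine schwartz_of_closed {f | ∃ A : SchwartzMap (V × P) ℂ, f = osc ν Θ A} ?_ ?_ ?_ ?_ _ ⟨A, rfl⟩
  · rintro _ ⟨A, rfl⟩ q
    exact (osc_hasFDerivAt ν Θ hΘ A q).2.differentiableAt
  · rintro _ ⟨A, rfl⟩ w
    let b := Module.finBasis ℝ Z
    let l : Fin (Module.finrank ℝ Z) → Z →L[ℝ] ℝ := 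
      fun i => LinearMap.toContinuousLinearMap (b.coord i)
    have hx : ∀ x : Z, x = ∑ i, l i x • b i := fun x => (b.sum_repr x).symm
    have hT1 : ∀ z, (fun x : V × P => (-I) * ((fderiv ℝ Θ x (0, w.2) z : ℝ) : ℂ)).HasTemperateGrowth := by
      intro z
      refine (Function.HasTemperateGrowth.const _).mul (tg_ofReal ?_)
      exact tg_clm ((ContinuousLinearMap.apply ℝ ℝ z).comp 
         (ContinuousLinearMap.apply ℝ (Z →L[ℝ] ℝ) ((0, w.2) : V × P))) (tg_fderiv hΘ)
    have hT2 : (fun x : V × P => (-I) * ((Θ x w.1 : ℝ) : ℂ)).HasTemperateGrowth := by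
      refine (Function.HasTemperateGrowth.const _).mul (tg_ofReal ?_)
      exact tg_clm (ContinuousLinearMap.apply ℝ ℝ w.1) hΘ
    choose A' hA' using fun i => hM (smulS (fun x : V × P => (-I) * ((fderiv ℝ Θ x (0, w.2) (b i) : ℝ) : ℂ)) A) (l i)
    let A0 : SchwartzMap (V × P) ℂ := SchwartzMap.evalCLM ℝ (V × P) ℂ ((0, w.2) : V × P)
      (SchwartzMap.fderivCLM ℝ (V × P) ℂ A)
    refine ⟨A0 + (smulS (fun x : V × P => (-I) * ((Θ x w.1 : ℝ) : ℂ)) A + ∑ i, A' i), ?_⟩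
    ext q
    rw [osc_add ν Θ cΘ, osc_add ν Θ cΘ, hsum]
    obtain ⟨hi, hd⟩ := osc_hasFDerivAt ν Θ hΘ A q
    rw [hd.fderiv, ContinuousLinearMap.integral_apply hi]
    simp_rw [← hA']
    have e1 := osc_integrable ν Θ cΘ A0 q
    have e2 := osc_integrable ν Θ cΘ (smulS (fun x : V × P => (-I) * ((Θ x w.1 : ℝ) : ℂ)) A) q
    have e3 := fun i => (osc_integrable ν Θ cΘ 
      (smulS (fun x : V × P => (-I) * ((fderiv ℝ Θ x (0, w.2) (b i) : ℝ) : ℂ)) A) q).const_mul (l i q.1 : ℂ)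
    unfold osc
    simp_rw [← integral_const_mul]
    rw [← integral_finsetSum _ (fun i _ => e3 i), ← integral_add e2 (integrable_finsetSum _ (fun i _ => e3 i))]
    refine Eq.trans ?_ (integral_add e1 (e2.add (integrable_finsetSum _ (fun i _ => e3 i))))
    refine integral_congr_ae (Filter.Eventually.of_forall fun v => ?_)
    simp only [oscD_apply, Pi.add_apply]
    simp_rw [smulS_apply (hT1 _), smulS_apply hT2]
    have : fderiv ℝ Θ (v, q.2) (0, w.2) q.1 = 
       ∑ i, l i q.1 * fderiv ℝ Θ (v, q.2) (0, w.2) (b i) := by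
      conv_lhs => rw [hx q.1]
      simp
    rw [this]
    have hA0 : A0 (v, q.2) = fderiv ℝ A (v, q.2) (0, w.2) := rfl
    rw [hA0]
    push_cast
    rw [mul_add, Finset.mul_sum, add_comm (∑ i, _)]
    congr 2
    · ring
    · exact Finset.sum_congr rfl fun i _ => by ring
  · rintro _ ⟨A, rfl⟩ L
    obtain ⟨A', hA'⟩ := hM A (L.comp (ContinuousLinearMap.inl ℝ Z P))
    have hT : (fun x : V × P => ((L (0, x.2) : ℝ) : ℂ)).HasTemperateGrowth := by
      refine tg_ofReal ?_
      exact (((L.comp (ContinuousLinearMap.inr ℝ Z P)).comp (ContinuousLinearMap.snd ℝ V P))).hasTemperateGrowth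
    refine ⟨A' + smulS (fun x : V × P => ((L (0, x.2) : ℝ) : ℂ)) A, ?_⟩
    ext q
    rw [osc_add ν Θ cΘ, ← hA']
    unfold osc
    simp_rw [smulS_apply hT]
    have : L q = L (q.1, 0) + L (0, q.2) := by rw [← map_add]; simp
    rw [this]
    push_cast
    simp_rw [add_mul, mul_assoc]
    rw [integral_const_mul]
    rfl
  · rintro _ ⟨A, rfl⟩
    obtain ⟨g, hg, hg0, hb⟩ := dom_aux ν A (fun _ => (1:ℝ)) (Function.HasTemperateGrowth.const _)
    refine ⟨∫ v, g v ∂ν, fun q => norm_integral_le_of_norm_le hg (Filter.Eventually.of_forall fun v => ?_)⟩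
    rw [norm_mul, norm_osc_exp]; simpa using hb v q.2

end osc

@[fun_prop]
lemma Function.HasTemperateGrowth.prodMk {E G H : Type*} [NormedAddCommGroup E] [NormedSpace ℝ E] [NormedAddCommGroup G] 
   [NormedSpace ℝ G] [NormedAddCommGroup H] [NormedSpace ℝ H] {f : E → G} {g : E → H} 
   (hf : f.HasTemperateGrowth) (hg : g.HasTemperateGrowth) : 
   (fun x => (f x, g x)).HasTemperateGrowth := by
  have := ((ContinuousLinearMap.inl ℝ G H).hasTemperateGrowth.comp hf).add 
    ((ContinuousLinearMap.inr ℝ G H).hasTemperateGrowth.comp hg)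
  convert this using 1
  ext x <;> simp

section pft
variable {V P : Type*} [NormedAddCommGroup V] [InnerProductSpace ℝ V] [FiniteDimensional ℝ V]
  [MeasurableSpace V] [BorelSpace V] 
  [NormedAddCommGroup P] [NormedSpace ℝ P] [FiniteDimensional ℝ P]

def sliceL {V P : Type*} [NormedAddCommGroup V] [NormedSpace ℝ V]
   [NormedAddCommGroup P] [NormedSpace ℝ P] (A : SchwartzMap (V × P) ℂ) (p : P) : SchwartzMap V ℂ :=
  SchwartzMap.compCLMOfAntilipschitz ℝ (g := fun v : V => (v, p)) (K := 1) 
    (by fun_prop) (fun x y => by simp [Prod.edist_eq]) A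

def sliceR {V P : Type*} [NormedAddCommGroup V] [NormedSpace ℝ V]
   [NormedAddCommGroup P] [NormedSpace ℝ P] (A : SchwartzMap (V × P) ℂ) (v : V) : SchwartzMap P ℂ :=
  SchwartzMap.compCLMOfAntilipschitz ℝ (g := fun p : P => (v, p)) (K := 1) 
    (by fun_prop) (fun x y => by simp [Prod.edist_eq]) A

open FourierTransform LineDeriv in
lemma pft (A : SchwartzMap (V × P) ℂ) : ∃ B : SchwartzMap (V × P) ℂ, ∀ x p,
    A (x, p) = ∫ v, B (v, p) * cexp (-(I * ((2 * Real.pi * inner ℝ v x : ℝ) : ℂ))) := by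
  let Θ : V × P → (V →L[ℝ] ℝ) := fun q => (-(2 * Real.pi)) • innerSL ℝ q.1
  have hΘ : Θ.HasTemperateGrowth := 
    (((-(2 * Real.pi)) • innerSL ℝ).comp (ContinuousLinearMap.fst ℝ V P)).hasTemperateGrowth
  have key : ∀ A : SchwartzMap (V × P) ℂ, ∀ q : V × P, osc volume Θ A q = 𝓕⁻ (sliceL A q.2) q.1 := by
    intro A q
    rw [SchwartzMap.fourierInv_coe, Real.fourierInv_eq']
    unfold osc
    refine integral_congr_ae (Filter.Eventually.of_forall fun v => ?_)
    simp only [smul_eq_mul]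
    rw [mul_comm]
    congr 1
    congr 1
    simp [Θ]
    ring
  obtain ⟨B, hB⟩ := osc_schwartz volume Θ hΘ (by
    intro A L
    obtain ⟨m, rfl⟩ := (InnerProductSpace.toDual ℝ V).surjective L
    refine ⟨(-(2 * Real.pi * I))⁻¹ • (∂_{((m, 0) : V × P)} A), fun q => ?_⟩
    have h2 : (-(2 * Real.pi * I) : ℂ) ≠ 0 := by simp [Real.pi_ne_zero]
    rw [key, key]
    have e1 : sliceL ((-(2 * Real.pi * I))⁻¹ • (∂_{((m, 0) : V × P)} A)) q.2 = 
        (-(2 * Real.pi * I))⁻¹ • (∂_{m} (sliceL A q.2)) := by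
      ext v
      show (-(2 * Real.pi * I))⁻¹ • (∂_{((m, 0) : V × P)} A) (v, q.2) =
         (-(2 * Real.pi * I))⁻¹ • (∂_{m} (sliceL A q.2)) v
      congr 1
      rw [SchwartzMap.lineDerivOp_apply, SchwartzMap.lineDerivOp_apply]
      unfold lineDeriv
      congr 1
      ext t
      show A _ = A _
      simp
    rw [e1, FourierTransform.fourierInv_smul, SchwartzMap.fourierInv_lineDerivOp_eq]
    have : (fun x : V => inner ℝ x m).HasTemperateGrowth := ((innerSL ℝ).flip m).hasTemperateGrowth
    simp only [SchwartzMap.smul_apply]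
    rw [SchwartzMap.smulLeftCLM_apply_apply this, smul_smul, inv_mul_cancel₀ h2, one_smul]
    simp [real_inner_comm]) A
  refine ⟨B, fun x p => ?_⟩
  have : sliceL B p = 𝓕⁻ (sliceL A p) := by
    ext v
    show B (v, p) = _
    rw [hB, key]
  have h2 : 𝓕 (sliceL B p) = sliceL A p := by rw [this]; simp
  show sliceL A p x = _
  rw [← h2, SchwartzMap.fourier_coe, Real.fourier_eq']
  refine integral_congr_ae (Filter.Eventually.of_forall fun v => ?_)
  simp only [smul_eq_mul]
  rw [mul_comm]
  congr 1
  congr 1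
  push_cast; ring
end pft

lemma pint {V P : Type*} [NormedAddCommGroup V] [NormedSpace ℝ V] [FiniteDimensional ℝ V]
  [MeasurableSpace V] [BorelSpace V] 
  [NormedAddCommGroup P] [NormedSpace ℝ P] [FiniteDimensional ℝ P] (ν : Measure V)
  [ν.HasTemperateGrowth] (A : SchwartzMap (V × P) ℂ) : 
    ∃ B : SchwartzMap P ℂ, ∀ p, B p = ∫ v, A (v, p) ∂ν := by
  obtain ⟨B, hB⟩ := osc_schwartz (Z := Fin 0 → ℝ) ν (fun _ => 0) 
    (Function.HasTemperateGrowth.const _) (by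
    intro A L
    refine ⟨0, fun q => ?_⟩
    have : q.1 = 0 := Subsingleton.elim _ _
    rw [this, map_zero]; simp [osc]) A
  refine ⟨sliceR B 0, fun p => ?_⟩
  show B (0, p) = _
  rw [hB]
  simp [osc]

lemma osc_line {P : Type*}  
  [NormedAddCommGroup P] [NormedSpace ℝ P] [FiniteDimensional ℝ P] 
  (θ θ' κ : ℝ × P → ℝ) (hθ : θ.HasTemperateGrowth) (hκ : κ.HasTemperateGrowth)
  (hd : ∀ τ p, HasDerivAt (fun τ => θ (τ, p)) (θ' (τ, p)) τ) (hk : ∀ q, κ q * θ' q = 1)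
  (A : SchwartzMap (ℝ × P) ℂ) : 
    ∃ B : SchwartzMap (ℝ × P) ℂ, ∀ u p, B (u, p) = 
      ∫ τ, A (τ, p) * cexp (-(I * (u * θ (τ, p) : ℝ))) := by
  have hΘ : (fun q => θ q • (ContinuousLinearMap.id ℝ ℝ)).HasTemperateGrowth := 
    hθ.smul (Function.HasTemperateGrowth.const _)
  have cθ : Continuous θ := hθ.1.continuous
  obtain ⟨B, hB⟩ := osc_schwartz volume (fun q => θ q • (ContinuousLinearMap.id ℝ ℝ)) hΘ (by
    intro A L
    let S : SchwartzMap (ℝ × P) ℂ := smulS (fun q => (κ q : ℂ)) A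
    have hS : ∀ q, S q = κ q * A q := smulS_apply (tg_ofReal hκ) A
    let S' : SchwartzMap (ℝ × P) ℂ := SchwartzMap.evalCLM ℝ (ℝ × P) ℂ ((1, 0) : ℝ × P)
      (SchwartzMap.fderivCLM ℝ (ℝ × P) ℂ S)
    have hS' : ∀ τ p, HasDerivAt (fun τ => S (τ, p)) (S' (τ, p)) τ := by
      intro τ p
      have h1 := (S.differentiable (τ, p)).hasFDerivAt
      have h2 : HasDerivAt (fun τ : ℝ => (τ, p)) (1, 0) τ := (hasDerivAt_id τ).prodMk (hasDerivAt_const _ _)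
      exact h1.comp_hasDerivAt τ h2
    refine ⟨(-I * L 1) • S', fun q => ?_⟩
    have e0 := osc_integrable volume (fun q => θ q • (ContinuousLinearMap.id ℝ ℝ)) hΘ.1.continuous A q
    have e1 := osc_integrable volume (fun q => θ q • (ContinuousLinearMap.id ℝ ℝ)) hΘ.1.continuous S q
    have e2 := osc_integrable volume (fun q => θ q • (ContinuousLinearMap.id ℝ ℝ)) hΘ.1.continuous S' q
    have h0 : ∀ τ : ℝ, HasDerivAt (fun τ => S (τ, q.2) * cexp (-(I * ((θ (τ, q.2) • (ContinuousLinearMap.id ℝ ℝ)) q.1 : ℝ))))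
       (S' (τ, q.2) * cexp (-(I * ((θ (τ, q.2) • (ContinuousLinearMap.id ℝ ℝ)) q.1 : ℝ))) 
       + (-I * q.1) * (A (τ, q.2) * cexp (-(I * ((θ (τ, q.2) • (ContinuousLinearMap.id ℝ ℝ)) q.1 : ℝ))))) τ := by
      intro τ
      have a1 := (hd τ q.2).ofReal_comp
      have a2 : HasDerivAt (fun τ => cexp (-(I * ((θ (τ, q.2) • (ContinuousLinearMap.id ℝ ℝ)) q.1 : ℝ)))) _ τ := 
        ((((a1.mul_const (q.1 : ℂ)).const_mul I).neg).cexp.congr_of_eventuallyEq (by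
         filter_upwards with t
         simp))
      refine ((hS' τ q.2).mul a2).congr_deriv ?_
      simp only [hS]
      have : (κ (τ, q.2) : ℂ) * θ' (τ, q.2) = 1 := by exact_mod_cast hk (τ, q.2)
      simp
      linear_combination (A (τ, q.2) * (cexp (-(I * (θ (τ, q.2) * q.1)))) * I * q.1) * this
    have h3 := integral_eq_zero_of_hasDerivAt_of_integrable h0 (e2.add (e0.const_mul _)) e1
    rw [integral_add e2 (e0.const_mul _), integral_const_mul] at h3
    have hL : L q.1 = q.1 * L 1 := by 
      conv_lhs => rw [show q.1 = q.1 • (1:ℝ) by simp]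
      rw [map_smul]; simp
    have h4 : osc volume (fun q => θ q • (ContinuousLinearMap.id ℝ ℝ)) ((-I * L 1) • S' : SchwartzMap (ℝ × P) ℂ) q 
      = (-I * L 1) * osc volume (fun q => θ q • (ContinuousLinearMap.id ℝ ℝ)) S' q := by
      unfold osc
      rw [← integral_const_mul]
      simp [mul_assoc]
    rw [h4, hL]
    unfold osc
    generalize (∫ τ, A (τ, q.2) * cexp (-(I * ((θ (τ, q.2) • (ContinuousLinearMap.id ℝ ℝ)) q.1 : ℝ)))) = J at *
    generalize (∫ τ, S' (τ, q.2) * cexp (-(I * ((θ (τ, q.2) • (ContinuousLinearMap.id ℝ ℝ)) q.1 : ℝ)))) = J' at *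
    push_cast
    linear_combination (q.1 * L 1 * J) * (Complex.I_sq) + (I * L 1) * h3) A
  refine ⟨B, fun u p => ?_⟩
  rw [hB]
  unfold osc
  simp [mul_comm]

lemma tg_of_seq {G : Type*} [NormedAddCommGroup G] [NormedSpace ℝ G] (g : ℕ → ℝ → G)
    (hd : ∀ n x, HasDerivAt (g n) (g (n+1) x) x)
    (hb : ∀ n, ∃ (k : ℕ) (C : ℝ), ∀ x, ‖g n x‖ ≤ C * (1 + ‖x‖) ^ k) : (g 0).HasTemperateGrowth := by
  have h1 : ∀ n, iteratedDeriv n (g 0) = g n := by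
    intro n
    induction n with
    | zero => simp
    | succ n ih => 
      rw [iteratedDeriv_succ, ih]; ext x; exact (hd n x).deriv
  refine ⟨contDiff_infty.2 fun n => ?_, fun n => ?_⟩
  · refine contDiff_of_differentiable_iteratedDeriv fun m _ x => ?_
    rw [h1]; exact (hd m x).differentiableAt
  · simp_rw [norm_iteratedFDeriv_eq_norm_iteratedDeriv, h1]
    exact hb n

lemma tg_iteratedDeriv {G : Type*} [NormedAddCommGroup G] [NormedSpace ℝ G] {f : ℝ → G}
    (hf : f.HasTemperateGrowth) (n : ℕ) : ∃ (k : ℕ) (C : ℝ), 0 ≤ C ∧ ∀ x, ‖iteratedDeriv n f x‖ ≤ C * (1 + ‖x‖) ^ k := by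
  obtain ⟨k, C, h⟩ := hf.2 n
  simp_rw [norm_iteratedFDeriv_eq_norm_iteratedDeriv] at h
  refine ⟨k, C, ?_, h⟩
  have := (norm_nonneg _).trans (h 0); simpa using this

lemma hasDerivAt_iteratedDeriv {G : Type*} [NormedAddCommGroup G] [NormedSpace ℝ G] {f : ℝ → G}
    (hf : ContDiff ℝ ((⊤ : ℕ∞) : WithTop ℕ∞) f) (n : ℕ) (x : ℝ) : HasDerivAt (iteratedDeriv n f) (iteratedDeriv (n+1) f x) x := by
  rw [iteratedDeriv_succ]
  exact (hf.differentiable_iteratedDeriv n (by exact_mod_cast WithTop.coe_lt_top _) x).hasDerivAt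

@[fun_prop]
lemma tg_cexp {E : Type*} [NormedAddCommGroup E] [NormedSpace ℝ E] {h : E → ℝ} 
    (hh : h.HasTemperateGrowth) : (fun x => cexp (-(I * (h x : ℂ)))).HasTemperateGrowth := by
  have : (fun x : ℝ => cexp (-(I * (x : ℂ)))).HasTemperateGrowth := by
    have := tg_of_seq (fun n (x : ℝ) => (-I)^n * cexp (-(I * (x : ℂ)))) ?_ ?_
    · simpa using this
    · intro n x
      have h1 : HasDerivAt (fun x : ℝ => (x : ℂ)) 1 x := Complex.ofRealCLM.hasDerivAt
      refine (((h1.const_mul I).neg.cexp).const_mul ((-I)^n)).congr_deriv ?_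
      simp only [Pi.neg_apply]
      ring
    · intro n
      refine ⟨0, 1, fun x => ?_⟩
      rw [norm_mul, norm_osc_exp]; simp
  exact this.comp hh

lemma tg_avg {G : Type*} [NormedAddCommGroup G] [NormedSpace ℝ G] [CompleteSpace G] (m : ℝ → G) (hm : m.HasTemperateGrowth)
    (a h : ℝ → ℝ) (ha : Continuous a) (hh : Continuous h) (s0 s1 : ℝ) :
    (fun v : ℝ => ∫ s in s0..s1, a s • m (h s * v)).HasTemperateGrowth := by
  have hmc : ∀ n, Continuous (iteratedDeriv n m) := fun n =>
    hm.1.continuous_iteratedDeriv n (by exact_mod_cast le_top)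
  obtain ⟨Ha, hHa⟩ := (isCompact_uIcc (a := s0) (b := s1)).exists_bound_of_continuousOn ha.continuousOn
  obtain ⟨Hh, hHh⟩ := (isCompact_uIcc (a := s0) (b := s1)).exists_bound_of_continuousOn hh.continuousOn
  have hHa0 : 0 ≤ Ha := (norm_nonneg _).trans (hHa s0 (by simp))
  have hHh0 : 0 ≤ Hh := (norm_nonneg _).trans (hHh s0 (by simp))
  have hbd : ∀ n, ∃ (k : ℕ) (C : ℝ), 0 ≤ C ∧ ∀ s ∈ Set.uIcc s0 s1, ∀ v, 
      ‖(a s * h s ^ n) • iteratedDeriv n m (h s * v)‖ ≤ C * (1 + ‖v‖) ^ k := by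
    intro n
    obtain ⟨k, C, hC, hk⟩ := tg_iteratedDeriv hm n
    refine ⟨k, Ha * Hh ^ n * (C * (1 + Hh) ^ k), by positivity, fun s hs v => ?_⟩
    have h1 := hHa s hs
    have h2 := hHh s hs
    calc _ = ‖a s‖ * ‖h s‖ ^ n * ‖iteratedDeriv n m (h s * v)‖ := by simp [norm_smul]
      _ ≤ Ha * Hh ^ n * (C * (1 + ‖h s * v‖) ^ k) := by gcongr; exact hk _
      _ ≤ Ha * Hh ^ n * (C * ((1 + Hh) * (1 + ‖v‖)) ^ k) := by
          gcongr
          rw [norm_mul]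
          have : ‖h s‖ * ‖v‖ ≤ Hh * ‖v‖ := by gcongr
          nlinarith [norm_nonneg v]
      _ = _ := by rw [mul_pow]; ring
  have := tg_of_seq (fun n (v : ℝ) => ∫ s in s0..s1, (a s * h s ^ n) • iteratedDeriv n m (h s * v)) ?_ ?_
  · simpa using this
  · intro n v
    obtain ⟨k, C, hC0, hC⟩ := hbd (n+1)
    refine (intervalIntegral.hasDerivAt_integral_of_dominated_loc_of_deriv_le (𝕜 := ℝ) 
      (F := fun v s => (a s * h s ^ n) • iteratedDeriv n m (h s * v))
      (F' := fun v s => (a s * h s ^ (n+1)) • iteratedDeriv (n+1) m (h s * v))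
      (bound := fun _ => C * (1 + (‖v‖ + 1)) ^ k)
      (Metric.ball_mem_nhds v one_pos) ?_ ?_ ?_ ?_ ?_ ?_).2
    · filter_upwards with x
      have := hmc n
      exact Continuous.aestronglyMeasurable (by fun_prop)
    · have := hmc n
      exact Continuous.intervalIntegrable (by fun_prop) _ _
    · have := hmc (n+1)
      exact Continuous.aestronglyMeasurable (by fun_prop)
    · filter_upwards with s hs x hx
      refine (hC s (Set.uIoc_subset_uIcc hs) x).trans ?_
      have hx' : ‖x‖ ≤ ‖v‖ + 1 := by
        have := norm_sub_norm_le x v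
        rw [Metric.mem_ball, dist_eq_norm] at hx; linarith
      gcongr
    · exact intervalIntegrable_const
    · filter_upwards with s hs x hx
      have h1 : HasDerivAt (iteratedDeriv n m) (iteratedDeriv (n+1) m (h s * x)) (h s * x) := 
        hasDerivAt_iteratedDeriv hm.1 n _
      have h2 : HasDerivAt (fun x => h s * x) (h s) x := by
        simpa using (hasDerivAt_id x).const_mul (h s)
      have h3 := (h1.scomp x h2).const_smul (a s * h s ^ n)
      refine h3.congr_deriv ?_
      rw [smul_smul]; ring_nf
  · intro n
    obtain ⟨k, C, hC0, hC⟩ := hbd n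
    refine ⟨k, C * |s1 - s0|, fun v => ?_⟩
    refine (intervalIntegral.norm_integral_le_of_norm_le_const (C := C * (1 + ‖v‖) ^ k) fun s hs => 
      hC s (Set.uIoc_subset_uIcc hs) v).trans (le_of_eq (by ring))

lemma tg_cut {G : Type*} [NormedAddCommGroup G] [NormedSpace ℝ G] (f : ℝ → G) (hf : ContDiff ℝ ((⊤ : ℕ∞) : WithTop ℕ∞) f)
    (h0 : ∀ v < (-1/4 : ℝ), f v = 0)
    (h1 : ∀ n, ∃ (k : ℕ) (C : ℝ), ∀ v ≥ 1, ‖iteratedDeriv n f v‖ ≤ C * (1 + ‖v‖) ^ k) :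
    f.HasTemperateGrowth := by
  refine ⟨hf, fun n => ?_⟩
  obtain ⟨k, C, hC⟩ := h1 n
  have hc : Continuous (iteratedDeriv n f) := hf.continuous_iteratedDeriv n (by exact_mod_cast le_top)
  obtain ⟨K, hK⟩ := (isCompact_Icc (a := (-1 : ℝ)) (b := 1)).exists_bound_of_continuousOn hc.continuousOn
  refine ⟨k, max C K, fun v => ?_⟩
  rw [norm_iteratedFDeriv_eq_norm_iteratedDeriv]
  have hK0 : 0 ≤ K := (norm_nonneg _).trans (hK 0 (by norm_num))
  have hp : 1 ≤ (1 + ‖v‖) ^ k := one_le_pow₀ (by linarith [norm_nonneg v])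
  rcases le_total 1 v with h | h
  · refine (hC v h).trans ?_
    gcongr; exact le_max_left _ _
  · rcases le_or_gt (-1) v with h' | h'
    · refine (hK v ⟨h', h⟩).trans ?_
      calc K ≤ max C K := le_max_right _ _
        _ = max C K * 1 := by ring
        _ ≤ _ := by gcongr
    · have : f =ᶠ[nhds v] fun _ => 0 := by
        filter_upwards [Iio_mem_nhds (show v < -1/4 by linarith)] with w hw
        exact h0 w hw
      rw [this.iteratedDeriv_eq]
      simp
      have : 0 ≤ max C K := hK0.trans (le_max_right _ _)
      positivity

def chi (v : ℝ) : ℝ := Real.smoothTransition (1 + 4 * v)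

lemma chi_smooth : ContDiff ℝ ((⊤ : ℕ∞) : WithTop ℕ∞) chi := by
  have : ContDiff ℝ ((⊤ : ℕ∞) : WithTop ℕ∞) (fun v : ℝ => 1 + 4 * v) := by fun_prop
  exact (Real.smoothTransition.contDiff (n := ⊤)).comp this
lemma chi_one {v : ℝ} (h : 0 ≤ v) : chi v = 1 := Real.smoothTransition.one_of_one_le (by linarith)
lemma chi_zero {v : ℝ} (h : v ≤ -1/4) : chi v = 0 := Real.smoothTransition.zero_of_nonpos (by linarith)
lemma chi_nonneg (v : ℝ) : 0 ≤ chi v := Real.smoothTransition.nonneg _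
lemma chi_le_one (v : ℝ) : chi v ≤ 1 := Real.smoothTransition.le_one _

lemma chi_ev {v : ℝ} (h : 1 ≤ v) : chi =ᶠ[nhds v] fun _ => 1 := by
  filter_upwards [Ioi_mem_nhds (show 0 < v by linarith)] with w hw
  exact chi_one (le_of_lt hw)

@[fun_prop]
lemma tg_chi : chi.HasTemperateGrowth := by
  refine tg_cut chi chi_smooth (fun v hv => chi_zero hv.le) fun n => ⟨0, 1, fun v hv => ?_⟩
  rw [(chi_ev hv).iteratedDeriv_eq]
  rcases n with _ | n <;> simp [iteratedDeriv_const]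

lemma tg_rpow {E : Type*} [NormedAddCommGroup E] [NormedSpace ℝ E] {f : E → ℝ} 
    (hf : f.HasTemperateGrowth) (h : ∀ x, 1/2 < f x) (r : ℝ) : 
    (fun x => f x ^ r).HasTemperateGrowth := by
  set t := {y : ℝ | 1 / 2 < y}
  have ht : Set.range f ⊆ t := by
    rintro - ⟨y, rfl⟩
    exact h y
  have hdiff : ContDiffOn ℝ ((⊤ : ℕ∞) : WithTop ℕ∞) (fun x ↦ x ^ r) t :=
    contDiffOn_fun_id.rpow_const_of_ne fun x hx ↦ (lt_trans (by norm_num) hx).ne'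
  have hunique : UniqueDiffOn ℝ t := (isOpen_lt' (1 / 2)).uniqueDiffOn
  apply Function.HasTemperateGrowth.comp' ht hunique hdiff _ hf
  intro N
  obtain ⟨k, hk⟩ := exists_nat_ge (max r <| (N - r) * Real.log 2 / (Real.log (3 / 2)))
  have hk₁ : r ≤ k := le_sup_left.trans hk
  have hk₂ : Real.log 2 * (N - r) ≤ (Real.log (3 / 2)) * k := by
    have := le_sup_right.trans hk
    field_simp at this
    grind
  use k, ∑ k ∈ Finset.range (N + 1), ‖Polynomial.eval r (descPochhammer ℝ k)‖, by positivity
  intro n hn x hx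
  have : ContDiffAt ℝ n (fun x ↦ x ^ r) x :=
    Real.contDiffAt_rpow_const <| Or.inl (lt_trans (by norm_num) hx).ne'
  rw [norm_iteratedFDerivWithin_eq_norm_iteratedDerivWithin,
    iteratedDerivWithin_eq_iteratedDeriv hunique this hx, iteratedDeriv_eq_iterate,
    Real.iter_deriv_rpow_const, norm_mul]
  gcongr 1
  · have : n ∈ Finset.range (N + 1) := by grind
    apply Finset.single_le_sum (fun _ _ ↦ by positivity) this
  have hx' : 1 / 2 < x := by simpa [t] using hx
  have hx'' : 0 < x := lt_of_lt_of_le (by norm_num) hx'.le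
  simp only [Real.norm_eq_abs]
  apply (Real.abs_rpow_le_abs_rpow _ _).trans
  by_cases! h' : 0 ≤ r - n
  · have : r - n ≤ k := by simpa using hk₁.trans (by simp)
    rw [← Real.rpow_natCast]
    exact (Real.rpow_le_rpow (by positivity) (by simp) h').trans
      (Real.rpow_le_rpow_of_exponent_le (by simp) this)
  have h' : 0 < n - r := by grind
  calc
    _ = x ^ (-(n - r)) := by
      rw [neg_sub]
      congr
      simpa using hx''.le
    _ ≤ (2 : ℝ) ^ (n - r) := by
      simp only [one_div, Set.mem_ofPred_eq, t] at hx
      rw [Real.rpow_neg_eq_inv_rpow]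
      gcongr
      exact ((inv_lt_comm₀ hx'' (by norm_num)).mpr hx).le
    _ = Real.exp (Real.log 2 * (n - r)) := by
      rw [Real.rpow_def_of_pos]
      norm_num
    _ ≤ Real.exp (Real.log (3 / 2) * k) := by
      gcongr 1
      apply le_trans _ hk₂
      gcongr
    _ ≤ (3 / 2) ^ k := by
      rw [← Real.rpow_natCast, Real.rpow_def_of_pos]
      norm_num
    _ ≤ _ := by
      gcongr
      grind

def qf (v : ℝ) : ℝ := 1 + v * chi v
lemma qf_gt (v : ℝ) : 1/2 < qf v := by
  unfold qf
  have h0 := chi_nonneg v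
  have h1 := chi_le_one v
  rcases le_total 0 v with h | h
  · nlinarith
  · rcases le_total v (-1/4) with h' | h'
    · rw [chi_zero h']; norm_num
    · nlinarith
lemma qf_sub (v : ℝ) : 1 ≤ qf v - v := by
  unfold qf
  have h0 := chi_nonneg v
  have h1 := chi_le_one v
  rcases le_total 0 v with h | h
  · rw [chi_one h]; linarith
  · nlinarith
lemma qf_eq {v : ℝ} (h : 0 ≤ v) : qf v = 1 + v := by simp [qf, chi_one h]
@[fun_prop]
lemma tg_qf : qf.HasTemperateGrowth := by unfold qf; fun_prop
def m1 (v : ℝ) : ℝ := (qf v)⁻¹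
@[fun_prop]
lemma tg_m1 : m1.HasTemperateGrowth := by
  have := tg_rpow tg_qf qf_gt (-1)
  simp only [Real.rpow_neg_one] at this
  exact this
def pf (v : ℝ) : ℝ := (qf v) ^ (-(1/2) : ℝ)
@[fun_prop]
lemma tg_pf : pf.HasTemperateGrowth := tg_rpow tg_qf qf_gt _
def mf (v : ℝ) : ℝ := 1 - v * m1 v
@[fun_prop]
lemma tg_mf : mf.HasTemperateGrowth := by unfold mf; fun_prop
def mi (v : ℝ) : ℝ := qf v * (qf v - v)⁻¹
@[fun_prop]
lemma tg_mi : mi.HasTemperateGrowth := by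
  have h := tg_rpow (f := fun v => qf v - v) (by fun_prop) (fun v => by linarith [qf_sub v]) (-1)
  simp only [Real.rpow_neg_one] at h
  exact tg_qf.mul h
lemma mi_mul (v : ℝ) : mi v * mf v = 1 := by
  unfold mi mf m1
  have h1 := qf_gt v
  have h2 := qf_sub v
  have h3 : qf v ≠ 0 := by linarith
  have h4 : qf v - v ≠ 0 := by linarith
  field_simp
lemma mf_eq {v : ℝ} (h : 0 ≤ v) : mf v = 1 / (1 + v) := by
  have : 1 + v ≠ 0 := by linarith
  unfold mf m1; rw [qf_eq h]; field_simp; ring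

def gf (v : ℝ) : ℝ := ∫ s in (0:ℝ)..1, mf (s ^ 2 * v)
@[fun_prop]
lemma tg_gf : gf.HasTemperateGrowth := by
  have := tg_avg mf tg_mf (fun _ => 1) (fun s => s ^ 2) (by fun_prop) (by fun_prop) 0 1
  simp only [one_smul] at this
  exact this
def kf (v : ℝ) : ℝ := ∫ s in (0:ℝ)..1, s ^ 2 * m1 (s ^ 2 * v)
@[fun_prop]
lemma tg_kf : kf.HasTemperateGrowth := by
  have := tg_avg m1 tg_m1 (fun s => s ^ 2) (fun s => s ^ 2) (by fun_prop) (by fun_prop) 0 1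
  simp only [smul_eq_mul] at this
  exact this
lemma cont_m1 : Continuous m1 := tg_m1.1.continuous
lemma cont_mf : Continuous mf := tg_mf.1.continuous

def thf (τ b : ℝ) : ℝ := τ * gf (τ ^ 2 * b)

lemma thf_eq (τ b : ℝ) : thf τ b = ∫ σ in (0:ℝ)..τ, mf (σ ^ 2 * b) := by
  have := intervalIntegral.mul_integral_comp_mul_left (a := 0) (b := 1) (f := fun σ => mf (σ ^ 2 * b)) (c := τ)
  simp only [mul_zero, mul_one] at this
  rw [← this, thf, gf]
  congr 1
  refine intervalIntegral.integral_congr fun s _ => ?_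
  show mf _ = mf _
  congr 1; ring

lemma thf_deriv (τ b : ℝ) : HasDerivAt (fun τ => thf τ b) (mf (τ ^ 2 * b)) τ := by
  simp_rw [thf_eq]
  have c : Continuous (fun σ : ℝ => mf (σ ^ 2 * b)) := by have := cont_mf; fun_prop
  exact intervalIntegral.integral_hasDerivAt_right (c.intervalIntegrable _ _) 
    (c.stronglyMeasurableAtFilter _ _) c.continuousAt

lemma thf_kf (τ b : ℝ) : b * τ ^ 3 * kf (τ ^ 2 * b) = τ - thf τ b := by
  unfold thf gf kf
  have c1 := cont_mf
  have : ∫ s in (0:ℝ)..1, mf (s ^ 2 * (τ ^ 2 * b)) = 1 - (τ ^ 2 * b) * ∫ s in (0:ℝ)..1, s ^ 2 * m1 (s ^ 2 * (τ ^ 2 * b)) := by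
    rw [← intervalIntegral.integral_const_mul]
    have c2 : Continuous (fun s : ℝ => (τ ^ 2 * b) * (s ^ 2 * m1 (s ^ 2 * (τ ^ 2 * b)))) := by 
      have := cont_m1; fun_prop
    have h1 : (1:ℝ) = ∫ s in (0:ℝ)..1, (1:ℝ) := by simp
    nth_rewrite 2 [h1]
    rw [← intervalIntegral.integral_sub (by simp) (c2.intervalIntegrable _ _)]
    refine intervalIntegral.integral_congr fun s _ => ?_
    simp only [mf]; ring
  rw [this]; ring

lemma thf_arctan (τ lam : ℝ) : lam * thf τ (lam ^ 2) = Real.arctan (lam * τ) := by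
  have h : ∀ τ, HasDerivAt (fun τ => lam * thf τ (lam ^ 2) - Real.arctan (lam * τ)) 0 τ := by
    intro τ
    have h1 := (thf_deriv τ (lam ^ 2)).const_mul lam
    have h2 : HasDerivAt (fun τ => Real.arctan (lam * τ)) _ τ := ((hasDerivAt_id τ).const_mul lam).arctan
    refine (h1.sub h2).congr_deriv ?_
    rw [mf_eq (by positivity)]
    simp only [id]
    field_simp
    ring
  have := is_const_of_deriv_eq_zero (fun τ => (h τ).differentiableAt) (fun τ => (h τ).deriv) τ 0
  simp [thf] at this
  simp [thf]; linarith

lemma key_phase (x : ℝ) (l : ℕ) : (pf (x ^ 2) : ℂ) * cexp (-(I * ((2 * l + 1) * Real.arctan x : ℝ))) 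
    = (1 - I * x) ^ l / (1 + I * x) ^ (l + 1) := by
  have hq : 0 < 1 + x ^ 2 := by positivity
  set s := Real.sqrt (1 + x ^ 2) with hs
  have hs0 : 0 < s := Real.sqrt_pos.2 hq
  have hs2 : (s : ℂ) ^ 2 = 1 + (x:ℂ) ^ 2 := by 
    have : s ^ 2 = 1 + x ^ 2 := Real.sq_sqrt hq.le
    exact_mod_cast this
  have hp : pf (x ^ 2) = s⁻¹ := by
    rw [pf, qf_eq (by positivity), Real.rpow_neg hq.le, hs, Real.sqrt_eq_rpow]
  have he : cexp (-(I * (Real.arctan x : ℝ))) = (1 - I * x) / s := by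
    rw [show -(I * (Real.arctan x : ℂ)) = ((-Real.arctan x : ℝ) : ℂ) * I by push_cast; ring,
      Complex.exp_mul_I, ← Complex.ofReal_cos, ← Complex.ofReal_sin, Real.cos_neg, Real.sin_neg, Real.cos_arctan,
      Real.sin_arctan, ← hs]
    push_cast
    field_simp
    ring
  have hsc : (s : ℂ) ≠ 0 := by exact_mod_cast hs0.ne'
  have hmul : (1 - I * x) * (1 + I * x) = (s:ℂ) ^ 2 := by
    rw [hs2]; linear_combination (-(x:ℂ) ^ 2) * Complex.I_sq
  have hne : (1 + I * (x:ℂ)) ≠ 0 := by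
    intro h
    rw [h, mul_zero] at hmul
    exact hsc (by simpa using hmul.symm)
  have e2 : cexp (-(I * ((2 * l + 1) * Real.arctan x : ℝ))) = ((1 - I * x) / s) ^ (2 * l + 1) := by
    rw [← he, ← Complex.exp_nat_mul]
    congr 1
    push_cast; ring
  rw [e2, hp, eq_div_iff (pow_ne_zero _ hne), div_pow]
  push_cast
  have : (1 - I * (x:ℂ)) ^ (2 * l + 1) * (1 + I * x) ^ (l + 1) = (1 - I * x) ^ l * ((s:ℂ) ^ 2) ^ (l + 1) := by
    rw [← hmul, mul_pow]; ring
  field_simp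
  rw [this]; ring

def Ef (z : ℂ) : ℂ := ∑' n : ℕ, (-z) ^ n / ((2 * n).factorial : ℂ)

lemma Ef_diff : Differentiable ℂ Ef := by
  intro z
  have h : DifferentiableOn ℂ Ef (Metric.ball 0 (‖z‖ + 1)) := by
    refine differentiableOn_tsum_of_summable_norm (u := fun n => (‖z‖ + 1) ^ n / (n.factorial : ℝ)) 
      (Real.summable_pow_div_factorial _) ?_ Metric.isOpen_ball ?_
    · intro n; fun_prop
    · intro n w hw
      rw [norm_div, norm_pow, norm_neg, Complex.norm_natCast]
      have : ‖w‖ ≤ ‖z‖ + 1 := by simpa using (Metric.mem_ball.1 hw).le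
      gcongr
      · linarith [n.zero_le]
  exact h.differentiableAt (Metric.isOpen_ball.mem_nhds (by simp))

def Er (v : ℝ) : ℂ := Ef v

lemma Er_smooth : ContDiff ℝ ((⊤ : ℕ∞) : WithTop ℕ∞) Er := by
  have h1 : ContDiff ℂ ((⊤ : ℕ∞) : WithTop ℕ∞) Ef := Ef_diff.contDiff
  have h2 : ContDiff ℝ ((⊤ : ℕ∞) : WithTop ℕ∞) Ef := h1.restrict_scalars ℝ
  exact h2.comp ofRealCLM.contDiff

lemma Er_sq (x : ℝ) : Er (x ^ 2) = Real.cos x := by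
  unfold Er Ef
  rw [Complex.ofReal_cos, ← (Complex.hasSum_cos (x:ℂ)).tsum_eq]
  refine tsum_congr fun n => ?_
  push_cast
  rw [neg_pow, pow_mul]

lemma hsq (n : ℕ) (x : ℝ) : HasDerivAt (fun x : ℝ => iteratedDeriv n Er (x ^ 2)) 
    (((2:ℕ) * x ^ (2 - 1)) • iteratedDeriv (n+1) Er (x ^ 2)) x :=
  HasDerivAt.scomp (g₁ := iteratedDeriv n Er) (h := fun x : ℝ => x ^ 2) x 
    (hasDerivAt_iteratedDeriv Er_smooth n (x^2)) (hasDerivAt_pow 2 x)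

lemma Er_ode (k : ℕ) : ∀ v > (0:ℝ), 4 * (v:ℂ) * iteratedDeriv (k+2) Er v + (4 * k + 2) * iteratedDeriv (k+1) Er v
    + iteratedDeriv k Er v = 0 := by
  have hD := fun n x => hasDerivAt_iteratedDeriv Er_smooth n x
  induction k with
  | zero =>
    have s1 : ∀ x : ℝ, 2 * (x:ℂ) * iteratedDeriv 1 Er (x ^ 2) = -Real.sin x := by
      intro x
      have a1 : HasDerivAt (fun x : ℝ => Er (x ^ 2)) (((2:ℕ) * x ^ (2 - 1)) • iteratedDeriv 1 Er (x ^ 2)) x := hsq 0 x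
      have a2 : HasDerivAt (fun x : ℝ => Er (x ^ 2)) (((-Real.sin x : ℝ) : ℂ)) x := by
        simp_rw [Er_sq]; exact (Real.hasDerivAt_cos x).ofReal_comp
      have := a1.unique a2
      simpa using this
    intro v hv
    obtain ⟨x, hx, rfl⟩ : ∃ x : ℝ, 0 < x ∧ v = x ^ 2 := ⟨Real.sqrt v, Real.sqrt_pos.2 hv, (Real.sq_sqrt hv.le).symm⟩
    have a1 : HasDerivAt (fun x : ℝ => iteratedDeriv 1 Er (x ^ 2)) (((2:ℕ) * x ^ (2 - 1)) • iteratedDeriv 2 Er (x ^ 2)) x := hsq 1 x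
    have a0 : HasDerivAt (fun x : ℝ => (x : ℂ)) 1 x := Complex.ofRealCLM.hasDerivAt
    have a2 := ((a0.const_mul 2).mul a1)
    have a3 : HasDerivAt (fun x : ℝ => 2 * (x:ℂ) * iteratedDeriv 1 Er (x ^ 2)) (((-Real.cos x : ℝ) : ℂ)) x := by
      simp_rw [s1]
      have := ((Real.hasDerivAt_sin x).neg).ofReal_comp
      simpa using this
    have := a2.unique a3
    simp at this
    simp [Er_sq]
    linear_combination this
  | succ k ih =>
    intro v hv
    have a0 : HasDerivAt (fun x : ℝ => (x : ℂ)) 1 v := Complex.ofRealCLM.hasDerivAt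
    have a1 := (((a0.const_mul 4).mul (hD (k+2) v)).add ((hD (k+1) v).const_mul (4 * (k:ℂ) + 2))).add (hD k v)
    have a2 := a1.unique ((hasDerivAt_const v (0:ℂ)).congr_of_eventuallyEq (by
      filter_upwards [Ioi_mem_nhds hv] with w hw
      simpa using ih w hw))
    push_cast
    rw [← a2]; ring

lemma Er_bd (k : ℕ) : ∃ C : ℝ, ∀ v ≥ (1:ℝ), ‖iteratedDeriv k Er v‖ ≤ C := by
  suffices H : ∀ k, (∃ C : ℝ, ∀ v ≥ (1:ℝ), ‖iteratedDeriv k Er v‖ ≤ C) ∧ 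
     (∃ C : ℝ, ∀ v ≥ (1:ℝ), ‖iteratedDeriv (k+1) Er v‖ ≤ C) from (H k).1
  intro k
  induction k with
  | zero =>
    constructor
    · refine ⟨1, fun v hv => ?_⟩
      have := Er_sq (Real.sqrt v)
      rw [Real.sq_sqrt (by linarith)] at this
      simp only [iteratedDeriv_zero, this, Complex.norm_real]
      exact Real.abs_cos_le_one _
    · refine ⟨1, fun v hv => ?_⟩
      have hv0 : 0 < v := by linarith
      obtain ⟨x, hx, rfl⟩ : ∃ x : ℝ, 0 < x ∧ v = x ^ 2 := ⟨Real.sqrt v, Real.sqrt_pos.2 hv0, (Real.sq_sqrt hv0.le).symm⟩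
      have a1 : HasDerivAt (fun x : ℝ => Er (x ^ 2)) (((2:ℕ) * x ^ (2 - 1)) • iteratedDeriv 1 Er (x ^ 2)) x := hsq 0 x
      have a2 : HasDerivAt (fun x : ℝ => Er (x ^ 2)) (((-Real.sin x : ℝ) : ℂ)) x := by
        simp_rw [Er_sq]; exact (Real.hasDerivAt_cos x).ofReal_comp
      have h := congrArg norm (a1.unique a2)
      have hx1 : 1 ≤ x := by nlinarith
      simp only [norm_smul, Complex.norm_real, norm_neg] at h
      have h2 : ‖Real.sin x‖ ≤ 1 := Real.abs_sin_le_one x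
      have h3 : (1:ℝ) ≤ ‖((2:ℕ):ℝ) * x ^ (2 - 1)‖ := by
        rw [Real.norm_of_nonneg (by positivity)]; simp; linarith
      have := norm_nonneg (iteratedDeriv 1 Er (x^2))
      nlinarith
  | succ k ih =>
    refine ⟨ih.2, ?_⟩
    obtain ⟨⟨C0, h0⟩, ⟨C1, h1⟩⟩ := ih
    refine ⟨(4 * k + 2) * C1 + C0, fun v hv => ?_⟩
    have e := Er_ode k v (by linarith)
    have e' : 4 * (v:ℂ) * iteratedDeriv (k+2) Er v = -((4 * k + 2) * iteratedDeriv (k+1) Er v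
     + iteratedDeriv k Er v) := by linear_combination e
    have n1 := congrArg norm e'
    rw [norm_neg, norm_mul] at n1
    have n2 : ‖((4 * k + 2) * iteratedDeriv (k+1) Er v + iteratedDeriv k Er v)‖ ≤ (4 * k + 2) * C1 + C0 := by
      refine (norm_add_le _ _).trans ?_
      rw [norm_mul]
      have : ‖(4 * (k:ℂ) + 2)‖ = 4 * k + 2 := by
        rw [show (4 * (k:ℂ) + 2) = ((4 * k + 2 : ℝ) : ℂ) by push_cast; ring, Complex.norm_real, Real.norm_of_nonneg (by positivity)]
      rw [this]
      gcongr
      · exact h1 v hv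
      · exact h0 v hv
    have n3 : (1:ℝ) ≤ ‖4 * (v:ℂ)‖ := by
      rw [norm_mul, Complex.norm_real, Real.norm_of_nonneg (by linarith)]; simp; linarith
    have := norm_nonneg (iteratedDeriv (k+2) Er v)
    nlinarith

def e2f (v : ℝ) : ℂ := chi v * Er v
lemma e2f_sq (x : ℝ) : e2f (x ^ 2) = Real.cos x := by
  rw [e2f, chi_one (sq_nonneg x), Er_sq]; simp
@[fun_prop]
lemma tg_e2f : e2f.HasTemperateGrowth := by
  have hs : ContDiff ℝ ((⊤ : ℕ∞) : WithTop ℕ∞) e2f := (ofRealCLM.contDiff.comp chi_smooth).mul Er_smooth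
  refine tg_cut _ hs (fun v hv => by simp [e2f, chi_zero hv.le]) fun n => ?_
  obtain ⟨C, hC⟩ := Er_bd n
  refine ⟨0, C, fun v hv => ?_⟩
  have : e2f =ᶠ[nhds v] Er := by
    filter_upwards [chi_ev hv] with w hw
    simp [e2f, hw]
  rw [this.iteratedDeriv_eq]
  simpa using hC v hv

def ef (v : ℝ) : ℂ := ∫ φ in (0:ℝ)..(2 * Real.pi), e2f (4 * Real.pi ^ 2 * Real.cos φ ^ 2 * v)
@[fun_prop]
lemma tg_ef : ef.HasTemperateGrowth := by
  have := tg_avg e2f tg_e2f (fun s => 1) (fun s => 4 * Real.pi ^ 2 * Real.cos s ^ 2) (by fun_prop) (by fun_prop) 0 (2 * Real.pi)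
  simp only [one_smul] at this
  exact this

lemma ef_spec (w : ℂ) : ∫ φ in (0:ℝ)..(2 * Real.pi), cexp (-(I * ((2 * Real.pi * (cexp (φ * I) * w).re : ℝ) : ℂ))) = ef (‖w‖ ^ 2) := by
  have hre : ∀ φ : ℝ, (cexp (φ * I) * w).re = ‖w‖ * Real.cos (φ + w.arg) := by
    intro φ
    conv_lhs => rw [← Complex.norm_mul_exp_arg_mul_I w]
    rw [mul_left_comm, ← Complex.exp_add, Complex.re_ofReal_mul, ← add_mul, ← Complex.ofReal_add, 
      Complex.exp_ofReal_mul_I_re]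
  simp_rw [hre]
  set f : ℝ → ℂ := fun φ => cexp (-(I * ((2 * Real.pi * (‖w‖ * Real.cos φ) : ℝ) : ℂ))) with hf
  have hper : Function.Periodic f (2 * Real.pi) := by
    intro φ; simp only [hf, Real.cos_add_two_pi]
  have hc : Continuous f := by fun_prop
  have sh : ∀ a : ℝ, ∫ φ in (0:ℝ)..(2 * Real.pi), f (φ + a) = ∫ φ in (0:ℝ)..(2 * Real.pi), f φ := by
    intro a
    rw [intervalIntegral.integral_comp_add_right]
    have := hper.intervalIntegral_add_eq a 0
    simpa [add_comm] using this
  show ∫ φ in (0:ℝ)..(2 * Real.pi), f (φ + w.arg) = _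
  rw [sh]
  have h2 : ∫ φ in (0:ℝ)..(2 * Real.pi), (f φ + f (φ + Real.pi)) = 2 * ∫ φ in (0:ℝ)..(2 * Real.pi), f φ := by
    have hc' : Continuous (fun φ => f (φ + Real.pi)) := by fun_prop
    rw [intervalIntegral.integral_add (hc.intervalIntegrable _ _) (hc'.intervalIntegrable _ _), sh]; ring
  have h3 : ∀ φ, f φ + f (φ + Real.pi) = 2 * e2f (4 * Real.pi ^ 2 * Real.cos φ ^ 2 * ‖w‖ ^ 2) := by
    intro φ
    rw [show 4 * Real.pi ^ 2 * Real.cos φ ^ 2 * ‖w‖ ^ 2 = (2 * Real.pi * (‖w‖ * Real.cos φ)) ^ 2 by ring, e2f_sq]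
    simp only [hf, Real.cos_add_pi]
    rw [Complex.ofReal_cos, Complex.two_cos]
    rw [add_comm]
    congr 2
    · push_cast; ring
    · push_cast; ring
  simp_rw [h3] at h2
  rw [intervalIntegral.integral_const_mul] at h2
  unfold ef
  exact (mul_left_cancel₀ two_ne_zero h2).symm

@[fun_prop]
lemma tg_fst {G H : Type*} [NormedAddCommGroup G] [NormedSpace ℝ G] [NormedAddCommGroup H] [NormedSpace ℝ H] :
    (fun x : G × H => x.1).HasTemperateGrowth := (ContinuousLinearMap.fst ℝ G H).hasTemperateGrowth
@[fun_prop]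
lemma tg_snd {G H : Type*} [NormedAddCommGroup G] [NormedSpace ℝ G] [NormedAddCommGroup H] [NormedSpace ℝ H] :
    (fun x : G × H => x.2).HasTemperateGrowth := (ContinuousLinearMap.snd ℝ G H).hasTemperateGrowth
@[fun_prop]
lemma tg_fst' {E G H : Type*} [NormedAddCommGroup E] [NormedSpace ℝ E] [NormedAddCommGroup G] [NormedSpace ℝ G] [NormedAddCommGroup H] [NormedSpace ℝ H] 
    {f : E → G × H} (hf : f.HasTemperateGrowth) : (fun x => (f x).1).HasTemperateGrowth := tg_fst.comp hf
@[fun_prop]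
lemma tg_snd' {E G H : Type*} [NormedAddCommGroup E] [NormedSpace ℝ E] [NormedAddCommGroup G] [NormedSpace ℝ G] [NormedAddCommGroup H] [NormedSpace ℝ H] 
    {f : E → G × H} (hf : f.HasTemperateGrowth) : (fun x => (f x).2).HasTemperateGrowth := tg_snd.comp hf

lemma pft1 (Φ : SchwartzMap (ℝ × ℝ × ℝ) ℂ) : ∃ B : SchwartzMap (ℝ × ℝ × ℝ) ℂ, 
    ∀ t p, Φ (t, p) = ∫ τ : ℝ, B (τ, p) * cexp (-(I * ((τ * t : ℝ) : ℂ))) := by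
  obtain ⟨B0, hB0⟩ := pft Φ
  have hpi : (2 * Real.pi) ≠ 0 := by positivity
  let e : (ℝ × ℝ × ℝ) ≃L[ℝ] (ℝ × ℝ × ℝ) := 
    (ContinuousLinearEquiv.unitsEquivAut ℝ (Units.mk0 (2 * Real.pi) hpi)⁻¹).prodCongr (ContinuousLinearEquiv.refl ℝ _)
  refine ⟨((2 * Real.pi)⁻¹ : ℝ) • SchwartzMap.compCLMOfContinuousLinearEquiv ℝ e B0, fun t p => ?_⟩
  rw [hB0]
  have := Measure.integral_comp_mul_left (fun v : ℝ => B0 (v, p) * cexp (-(I * ((2 * Real.pi * inner ℝ v t : ℝ) : ℂ)))) (2 * Real.pi)⁻¹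
  rw [inv_inv, abs_of_pos (by positivity)] at this
  rw [← inv_smul_eq_iff₀ hpi] at this
  rw [← this, ← integral_smul]
  refine integral_congr_ae (Filter.Eventually.of_forall fun v => ?_)
  simp only [SchwartzMap.smul_apply, SchwartzMap.compCLMOfContinuousLinearEquiv_apply, Function.comp]
  rw [smul_mul_assoc]
  congr 1
  have he : e (v, p) = ((2 * Real.pi)⁻¹ * v, p) := by
    simp [e, mul_comm]
  rw [he]
  congr 4
  simp
  field_simp

lemma stepf (Φ : SchwartzMap (ℝ × ℝ × ℝ) ℂ) : ∃ B f : SchwartzMap (ℝ × ℝ × ℝ) ℂ, 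
    (∀ t p, Φ (t, p) = ∫ τ : ℝ, B (τ, p) * cexp (-(I * ((τ * t : ℝ) : ℂ)))) ∧ 
    (∀ (lam : ℝ) (l : ℕ) (r : ℝ), f (lam * (2 * l + 1) + r ^ 2, lam ^ 2, lam * r) = 
      ∫ τ : ℝ, B (τ, lam ^ 2, lam * r) * (cexp (-(I * ((τ * r ^ 2 : ℝ) : ℂ))) * 
        ((1 - I * (lam * τ : ℝ)) ^ l / (1 + I * (lam * τ : ℝ)) ^ (l + 1)))) ∧
    (∀ t, f (t, 0, 0) = Φ (t, 0, 0)) := by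
  obtain ⟨B, hB⟩ := pft1 Φ
  let amp : ℝ × ℝ × ℝ → ℂ := fun q => (pf (q.1 ^ 2 * q.2.1) : ℝ) * cexp (-(I * ((q.2.2 ^ 2 * (q.1 ^ 3 * kf (q.1 ^ 2 * q.2.1)) : ℝ) : ℂ)))
  have hu : (fun q : ℝ × ℝ × ℝ => q.1 ^ 2 * q.2.1).HasTemperateGrowth := by fun_prop
  have hamp : amp.HasTemperateGrowth := by
    refine (tg_ofReal (tg_pf.comp hu)).mul (tg_cexp ?_)
    have := tg_kf.comp hu
    simp only [Function.comp_def] at this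
    fun_prop
  obtain ⟨f, hf⟩ := osc_line (P := ℝ × ℝ) (fun q => thf q.1 q.2.1) (fun q => mf (q.1 ^ 2 * q.2.1)) 
     (fun q => mi (q.1 ^ 2 * q.2.1)) (by
       unfold thf
       have := tg_gf.comp hu
       simp only [Function.comp_def] at this
       fun_prop) (tg_mi.comp hu) (fun τ p => thf_deriv τ p.1) (fun q => mi_mul _) (smulS amp B)
  refine ⟨B, f, hB, fun lam l r => ?_, fun t => ?_⟩
  · rw [hf]
    refine integral_congr_ae (Filter.Eventually.of_forall fun τ => ?_)
    simp only [smulS_apply hamp]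
    have h1 : τ ^ 2 * lam ^ 2 = (lam * τ) ^ 2 := by ring
    rw [← key_phase]
    simp only [amp]
    rw [h1]
    have : cexp (-(I * (((lam * r) ^ 2 * (τ ^ 3 * kf ((lam * τ) ^ 2)) : ℝ) : ℂ))) * 
      cexp (-(I * (((lam * (2 * l + 1) + r ^ 2) * thf τ (lam ^ 2) : ℝ) : ℂ))) = 
       cexp (-(I * ((τ * r ^ 2 : ℝ) : ℂ))) * cexp (-(I * (((2 * l + 1) * Real.arctan (lam * τ) : ℝ) : ℂ))) := by
      rw [← Complex.exp_add, ← Complex.exp_add]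
      congr 1
      have h2 := thf_kf τ (lam ^ 2)
      rw [h1] at h2
      have h3 := thf_arctan τ lam
      rw [← neg_add, ← neg_add, ← mul_add, ← mul_add, ← Complex.ofReal_add, ← Complex.ofReal_add, ← h3]
      have h4 : (lam * r) ^ 2 * (τ ^ 3 * kf ((lam * τ) ^ 2)) + (lam * (2 * l + 1) + r ^ 2) * thf τ (lam ^ 2) = 
         τ * r ^ 2 + (2 * l + 1) * (lam * thf τ (lam ^ 2)) := by linear_combination r ^ 2 * h2
      rw [h4]
    linear_combination (B (τ, lam ^ 2, lam * r) * (pf ((lam * τ) ^ 2) : ℝ)) * this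
  · rw [hf, hB]
    refine integral_congr_ae (Filter.Eventually.of_forall fun τ => ?_)
    simp only [smulS_apply hamp]
    have hp : pf 0 = 1 := by simp [pf, qf]
    have hg : thf τ 0 = τ := by
      simp [thf, gf, mf]
    simp [amp, hp, hg, mul_comm]

lemma tensorS {V P : Type*} [NormedAddCommGroup V] [NormedSpace ℝ V]
  [NormedAddCommGroup P] [NormedSpace ℝ P] (G : SchwartzMap V ℂ) (K : SchwartzMap P ℂ) : 
    ∃ T : SchwartzMap (V × P) ℂ, ∀ x p, T (x, p) = G x * K p := by
  have hG : ContDiff ℝ ((⊤ : ℕ∞) : WithTop ℕ∞) (fun q : V × P => G q.1) := (G.smooth ⊤).comp contDiff_fst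
  have hK : ContDiff ℝ ((⊤ : ℕ∞) : WithTop ℕ∞) (fun q : V × P => K q.2) := (K.smooth ⊤).comp contDiff_snd
  have bG : ∀ i (q : V × P), ‖iteratedFDeriv ℝ i (fun q : V × P => G q.1) q‖ ≤ ‖iteratedFDeriv ℝ i G q.1‖ := by
    intro i q
    have h1 := (ContinuousLinearMap.fst ℝ V P).iteratedFDeriv_comp_right (G.smooth ⊤) q (i := i) (by exact_mod_cast le_top)
    have : (fun q : V × P => G q.1) = G ∘ (ContinuousLinearMap.fst ℝ V P) := rfl
    rw [this, h1]
    refine (ContinuousMultilinearMap.norm_compContinuousLinearMap_le _ _).trans ?_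
    refine mul_le_of_le_one_right (norm_nonneg _) ?_
    exact Finset.prod_le_one (fun _ _ => norm_nonneg _) (fun _ _ => ContinuousLinearMap.norm_fst_le _ _ _)
  have bK : ∀ i (q : V × P), ‖iteratedFDeriv ℝ i (fun q : V × P => K q.2) q‖ ≤ ‖iteratedFDeriv ℝ i K q.2‖ := by
    intro i q
    have h1 := (ContinuousLinearMap.snd ℝ V P).iteratedFDeriv_comp_right (K.smooth ⊤) q (i := i) (by exact_mod_cast le_top)
    have : (fun q : V × P => K q.2) = K ∘ (ContinuousLinearMap.snd ℝ V P) := rfl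
    rw [this, h1]
    refine (ContinuousMultilinearMap.norm_compContinuousLinearMap_le _ _).trans ?_
    refine mul_le_of_le_one_right (norm_nonneg _) ?_
    exact Finset.prod_le_one (fun _ _ => norm_nonneg _) (fun _ _ => ContinuousLinearMap.norm_snd_le _ _ _)
  refine ⟨⟨fun q => G q.1 * K q.2, hG.mul hK, fun k n => ?_⟩, fun x p => rfl⟩
  let CG := 2 ^ k * ((Finset.Iic (k, n)).sup (fun m => SchwartzMap.seminorm ℝ m.1 m.2)) G
  let CK := 2 ^ k * ((Finset.Iic (k, n)).sup (fun m => SchwartzMap.seminorm ℝ m.1 m.2)) K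
  refine ⟨∑ i ∈ Finset.range (n + 1), (n.choose i : ℝ) * CG * CK, fun q => ?_⟩
  have h1 := norm_iteratedFDeriv_mul_le (𝕜 := ℝ) (N := ((⊤ : ℕ∞) : WithTop ℕ∞)) hG hK q (n := n) (by exact_mod_cast le_top)
  refine (mul_le_mul_of_nonneg_left h1 (by positivity)).trans ?_
  rw [Finset.mul_sum]
  refine Finset.sum_le_sum fun i hi => ?_
  have hi' : i ≤ n := by simpa [Nat.lt_succ_iff] using hi
  have g1 : (1 + ‖q.1‖) ^ k * ‖iteratedFDeriv ℝ i G q.1‖ ≤ CG := 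
    SchwartzMap.one_add_le_sup_seminorm_apply (𝕜 := ℝ) (m := (k, n)) le_rfl hi' G q.1
  have k1 : (1 + ‖q.2‖) ^ k * ‖iteratedFDeriv ℝ (n - i) K q.2‖ ≤ CK := 
    SchwartzMap.one_add_le_sup_seminorm_apply (𝕜 := ℝ) (m := (k, n)) le_rfl (Nat.sub_le _ _) K q.2
  have hq : ‖q‖ ^ k ≤ (1 + ‖q.1‖) ^ k * (1 + ‖q.2‖) ^ k := by
    rw [← mul_pow]
    refine pow_le_pow_left₀ (norm_nonneg _) ?_ _
    rw [Prod.norm_def]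
    have := norm_nonneg q.1
    have := norm_nonneg q.2
    refine max_le ?_ ?_ <;> nlinarith
  calc _ ≤ ((1 + ‖q.1‖) ^ k * (1 + ‖q.2‖) ^ k) * ((n.choose i : ℝ) * ‖iteratedFDeriv ℝ i G q.1‖ * ‖iteratedFDeriv ℝ (n - i) K q.2‖) := by
        gcongr
        · exact bG i q
        · exact bK _ q
    _ = (n.choose i : ℝ) * (((1 + ‖q.1‖) ^ k * ‖iteratedFDeriv ℝ i G q.1‖) * ((1 + ‖q.2‖) ^ k * ‖iteratedFDeriv ℝ (n - i) K q.2‖)) := by ring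
    _ ≤ (n.choose i : ℝ) * (CG * CK) := by gcongr
    _ = _ := by ring

lemma bumpS : ∃ K : SchwartzMap ℝ ℂ, K 0 = 1 := by
  let f : ContDiffBump (0:ℝ) := ⟨1, 2, by norm_num, by norm_num⟩
  have h1 : HasCompactSupport (fun x : ℝ => ((f x : ℝ) : ℂ)) := f.hasCompactSupport.comp_left (g := fun x : ℝ => (x : ℂ)) (by simp)
  have h2 : ContDiff ℝ ((⊤ : ℕ∞) : WithTop ℕ∞) (fun x : ℝ => ((f x : ℝ) : ℂ)) := Complex.ofRealCLM.contDiff.comp f.contDiff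
  refine ⟨h1.toSchwartzMap h2, ?_⟩
  show ((f 0 : ℝ) : ℂ) = 1
  rw [f.one_of_mem_closedBall (by simp [f.rIn_pos.le])]
  simp

lemma stage2 (Ψ : SchwartzMap (ℝ × ℝ × ℝ × ℝ) ℂ) : ∃ Φ : SchwartzMap (ℝ × ℝ × ℝ) ℂ, 
    ∀ D t b c : ℝ, t * b - c ^ 2 = D ^ 2 → Φ (t, b, c) = (1/2) * (Ψ (D, t, b, c) + Ψ (-D, t, b, c)) := by
  obtain ⟨C, hC⟩ := pft Ψ
  have hu : (fun q : ℝ × ℝ × ℝ × ℝ => e2f (4 * Real.pi ^ 2 * (q.2.1 * q.2.2.1 - q.2.2.2 ^ 2) * q.1 ^ 2)).HasTemperateGrowth := by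
    refine tg_e2f.comp (f := fun q : ℝ × ℝ × ℝ × ℝ => (4 * Real.pi ^ 2 * (q.2.1 * q.2.2.1 - q.2.2.2 ^ 2) * q.1 ^ 2)) ?_
    fun_prop
  obtain ⟨Φ, hΦ⟩ := pint (volume : Measure ℝ) (smulS (fun q : ℝ × ℝ × ℝ × ℝ => e2f (4 * Real.pi ^ 2 * (q.2.1 * q.2.2.1 - q.2.2.2 ^ 2) * q.1 ^ 2)) C : SchwartzMap (ℝ × ℝ × ℝ × ℝ) ℂ)
  refine ⟨Φ, fun D t b c h => ?_⟩
  have i1 : ∀ x : ℝ, Integrable (fun σ : ℝ => C (σ, t, b, c) * cexp (-(I * ((2 * Real.pi * inner ℝ σ x : ℝ) : ℂ)))) := by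
    intro x
    have : Integrable (fun σ : ℝ => C (σ, t, b, c)) := (sliceL C (t, b, c)).integrable
    refine this.mul_bdd (c := 1) ?_ ?_
    · apply Continuous.aestronglyMeasurable; fun_prop
    · filter_upwards with σ
      rw [norm_osc_exp]
  rw [hΦ, hC, hC, ← integral_add (i1 _) (i1 _), ← integral_const_mul]
  refine integral_congr_ae (Filter.Eventually.of_forall fun σ => ?_)
  simp only [smulS_apply hu]
  rw [h, show 4 * Real.pi ^ 2 * D ^ 2 * σ ^ 2 = (2 * Real.pi * (D * σ)) ^ 2 by ring, e2f_sq]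
  rw [Complex.ofReal_cos, Complex.cos]
  simp
  rw [show ((2:ℂ) * Real.pi * (D * σ) * I) = (I * (2 * Real.pi * (D * σ))) by ring]
  ring

abbrev W4 := WithLp 2 (ℂ × ℂ)

lemma tg_w1 : (fun X : W4 => X.fst).HasTemperateGrowth := 
  ((ContinuousLinearMap.fst ℝ ℂ ℂ).comp (WithLp.prodContinuousLinearEquiv 2 ℝ ℂ ℂ).toContinuousLinearMap).hasTemperateGrowth
lemma tg_w2 : (fun X : W4 => X.snd).HasTemperateGrowth := 
  ((ContinuousLinearMap.snd ℝ ℂ ℂ).comp (WithLp.prodContinuousLinearEquiv 2 ℝ ℂ ℂ).toContinuousLinearMap).hasTemperateGrowth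
@[fun_prop]
lemma tg_re {E : Type*} [NormedAddCommGroup E] [NormedSpace ℝ E] {f : E → ℂ} (hf : f.HasTemperateGrowth) :
   (fun x => (f x).re).HasTemperateGrowth := Complex.reCLM.hasTemperateGrowth.comp hf
@[fun_prop]
lemma tg_im {E : Type*} [NormedAddCommGroup E] [NormedSpace ℝ E] {f : E → ℂ} (hf : f.HasTemperateGrowth) :
   (fun x => (f x).im).HasTemperateGrowth := Complex.imCLM.hasTemperateGrowth.comp hf

/-- quadratic map -/
def sqP (z : ℂ) : ℝ := z.re ^ 2 + z.im ^ 2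
/-- the real part of `z` times the conjugate of `w` -/
def reP (z w : ℂ) : ℝ := z.re * w.re + z.im * w.im
/-- the imaginary part of `z` times the conjugate of `w` -/
def imP (z w : ℂ) : ℝ := z.im * w.re - z.re * w.im
def nP (S : ℝ × ℝ × ℝ × ℝ) : ℝ := S.1 ^ 2 + S.2.1 ^ 2 + S.2.2.1 ^ 2 + S.2.2.2 ^ 2
def PP (z w : ℂ) : ℝ × ℝ × ℝ × ℝ := (imP z w, sqP z, sqP w, reP z w)
def AP (Y : W4) (S : ℝ × ℝ × ℝ × ℝ) : ℝ := S.2.1 * sqP Y.fst + S.2.2.1 * sqP Y.snd + 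
  2 * (S.2.2.2 * reP Y.fst Y.snd + S.1 * imP Y.fst Y.snd)

lemma tg_nPP : (fun X : W4 => nP (PP X.fst X.snd)).HasTemperateGrowth := by
  have h1 := tg_w1
  have h2 := tg_w2
  unfold nP PP imP sqP reP
  fun_prop

lemma nPP_rot (φ : ℝ) (z w : ℂ) : PP (cexp (φ * I) * z) (cexp (φ * I) * w) = PP z w := by
  have h : (cexp (φ * I)).re ^ 2 + (cexp (φ * I)).im ^ 2 = 1 := by
    rw [Complex.exp_ofReal_mul_I_re, Complex.exp_ofReal_mul_I_im]; exact Real.cos_sq_add_sin_sq φ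
  simp only [PP, imP, sqP, reP, Complex.mul_re, Complex.mul_im, Prod.mk.injEq]
  generalize (cexp (φ * I)).re = a at *
  generalize (cexp (φ * I)).im = b at *
  refine ⟨?_, ?_, ?_, ?_⟩
  · linear_combination (z.im * w.re - z.re * w.im) * h
  · linear_combination (z.re^2+z.im^2) * h
  · linear_combination (w.re^2+w.im^2) * h
  · linear_combination (z.re * w.re + z.im * w.im) * h

lemma AP_eq (Y : W4) (z w : ℂ) : AP Y (PP z w) = ‖starRingEnd ℂ Y.fst * z + starRingEnd ℂ Y.snd * w‖ ^ 2 := by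
  rw [← Complex.normSq_eq_norm_sq, Complex.normSq_apply]
  simp [AP, PP, sqP, reP, imP]
  ring

lemma stage1 (G : SchwartzMap (ℂ × ℂ) ℂ) (hr : ∀ (φ : ℝ) (z w : ℂ), G (cexp (φ * I) * z, cexp (φ * I) * w) = G (z, w)) : 
    ∃ Ψ : SchwartzMap (ℝ × ℝ × ℝ × ℝ) ℂ, ∀ z w, G (z, w) = Ψ (PP z w) := by
  obtain ⟨K, hK⟩ := bumpS
  let G' : SchwartzMap W4 ℂ := SchwartzMap.compCLMOfContinuousLinearEquiv ℝ (WithLp.prodContinuousLinearEquiv 2 ℝ ℂ ℂ) G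
  obtain ⟨T, hT⟩ := tensorS G' K
  have hn := tg_nPP
  let sh : W4 × ℝ → W4 × ℝ := fun q => (q.1, q.2 - nP (PP q.1.fst q.1.snd))
  have hsh : sh.HasTemperateGrowth := by
    have := hn.comp (tg_fst (G := W4) (H := ℝ))
    simp only [Function.comp_def] at this
    fun_prop
  obtain ⟨k, C, hk⟩ := hn.2 0
  have hsb : ∃ (k : ℕ) (C : ℝ), ∀ x, ‖x‖ ≤ C * (1 + ‖sh x‖) ^ k := by
    have hC : 0 ≤ C := by
      have := hk 0
      simp at this
      exact (abs_nonneg _).trans this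
    refine ⟨k + 1, 1 + C, fun q => ?_⟩
    have h1 : ‖q.1‖ ≤ ‖sh q‖ := by 
      exact (norm_fst_le (sh q))
    have h2 : ‖q.2 - nP (PP q.1.fst q.1.snd)‖ ≤ ‖sh q‖ := norm_snd_le (sh q)
    have h3 := hk q.1
    rw [norm_iteratedFDeriv_zero] at h3
    have h4 : C * (1 + ‖q.1‖) ^ k ≤ C * (1 + ‖sh q‖) ^ k := by gcongr
    have h5 : ‖q.2‖ ≤ ‖sh q‖ + C * (1 + ‖sh q‖) ^ k := by
      have := norm_add_le (q.2 - nP (PP q.1.fst q.1.snd)) (nP (PP q.1.fst q.1.snd))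
      rw [sub_add_cancel] at this
      linarith
    have h0 := norm_nonneg (sh q)
    have h6 : (1 : ℝ) ≤ (1 + ‖sh q‖) ^ k := one_le_pow₀ (by linarith)
    have h7 : ‖sh q‖ + C * (1 + ‖sh q‖) ^ k ≤ (1 + C) * (1 + ‖sh q‖) ^ (k + 1) := by
      rw [pow_succ]
      generalize (1 + ‖sh q‖) ^ k = m at *
      generalize ‖sh q‖ = u at *
      nlinarith [mul_nonneg hC (mul_nonneg h0 (by linarith : 0 ≤ m)), mul_nonneg h0 (by linarith : 0 ≤ m-1)]
    rw [Prod.norm_def]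
    refine max_le ?_ (h5.trans h7)
    refine (h1.trans ?_).trans h7
    have : 0 ≤ C * (1 + ‖sh q‖) ^ k := by positivity
    linarith
  let A : SchwartzMap (W4 × ℝ) ℂ := SchwartzMap.compCLM ℝ hsh hsb T
  have hA : ∀ X s, A (X, s) = G (X.fst, X.snd) * K (s - nP (PP X.fst X.snd)) := fun X s => hT _ _
  obtain ⟨B, hB⟩ := pft A
  let g2 : W4 × (ℝ × ℝ × ℝ × ℝ) → W4 × ℝ := fun q => (q.1, nP q.2)
  have hg2 : g2.HasTemperateGrowth := by
    simp only [g2, nP]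
    fun_prop
  have hgb : ∃ (k : ℕ) (C : ℝ), ∀ x, ‖x‖ ≤ C * (1 + ‖g2 x‖) ^ k := by
    refine ⟨1, 1, fun q => ?_⟩
    have h1 : ‖q.1‖ ≤ ‖g2 q‖ := by 
      exact (norm_fst_le (g2 q))
    have h2 : ‖nP q.2‖ ≤ ‖g2 q‖ := norm_snd_le (g2 q)
    have h3 : ∀ x m : ℝ, x ^ 2 ≤ m → ‖x‖ ≤ 1 + m := by
      intro x m h
      rw [Real.norm_eq_abs]
      rw [← sq_abs] at h
      nlinarith [abs_nonneg x]
    have h4 : nP q.2 ≤ ‖g2 q‖ := (le_abs_self _).trans h2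
    unfold nP at h4
    have := norm_nonneg (g2 q)
    rw [one_mul, pow_one]
    simp only [Prod.norm_def q, Prod.norm_def q.2, Prod.norm_def q.2.2, Prod.norm_def q.2.2.2]
    refine max_le (by linarith) (max_le (h3 _ _ ?_) (max_le (h3 _ _ ?_) (max_le (h3 _ _ ?_) (h3 _ _ ?_)))) <;> nlinarith
  let B2 : SchwartzMap (W4 × (ℝ × ℝ × ℝ × ℝ)) ℂ := SchwartzMap.compCLM ℝ hg2 hgb B
  have hB2 : ∀ Y S, B2 (Y, S) = B (Y, nP S) := fun Y S => rfl
  have hAP : (fun q : W4 × (ℝ × ℝ × ℝ × ℝ) => ef (AP q.1 q.2)).HasTemperateGrowth := by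
    refine tg_ef.comp (f := fun q : W4 × (ℝ × ℝ × ℝ × ℝ) => (AP q.1 q.2)) ?_
    have h1 := tg_w1.comp (tg_fst (G := W4) (H := (ℝ × ℝ × ℝ × ℝ)))
    have h2 := tg_w2.comp (tg_fst (G := W4) (H := (ℝ × ℝ × ℝ × ℝ)))
    simp only [Function.comp_def] at h1 h2
    unfold AP sqP reP imP
    fun_prop
  obtain ⟨Ψ, hΨ⟩ := pint (volume : Measure W4) (smulS (fun q : W4 × (ℝ × ℝ × ℝ × ℝ) => ef (AP q.1 q.2)) B2)
  refine ⟨((2 * Real.pi)⁻¹ : ℝ) • Ψ, fun z w => ?_⟩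
  rw [SchwartzMap.smul_apply, hΨ]
  simp only [smulS_apply hAP, hB2, AP_eq, ← ef_spec]
  set n := nP (PP z w) with hn'
  have e1 : ∀ φ : ℝ, G (z, w) = ∫ Y : W4, B (Y, n) * cexp (-(I * ((2 * Real.pi * (cexp (φ * I) * (starRingEnd ℂ Y.fst * z + starRingEnd ℂ Y.snd * w)).re : ℝ) : ℂ))) := by
    intro φ
    have h1 := hB (WithLp.toLp 2 (cexp (φ * I) * z, cexp (φ * I) * w)) n
    rw [hA] at h1
    simp only [WithLp.toLp_fst, WithLp.toLp_snd, nPP_rot] at h1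
    rw [hr, ← hn', sub_self, hK, mul_one] at h1
    rw [h1]
    refine integral_congr_ae (Filter.Eventually.of_forall fun Y => ?_)
    simp only
    congr 6
    rw [WithLp.prod_inner_apply]
    simp [Complex.inner]
    ring
  have e2 : ∫ φ in (0:ℝ)..(2 * Real.pi), G (z, w) = ((2 * Real.pi : ℝ)) • G (z, w) := by simp
  have e3 : ∫ φ in (0:ℝ)..(2 * Real.pi), G (z, w) = ∫ Y : W4, ∫ φ in (0:ℝ)..(2 * Real.pi), B (Y, n) * cexp (-(I * ((2 * Real.pi * (cexp (φ * I) * (starRingEnd ℂ Y.fst * z + starRingEnd ℂ Y.snd * w)).re : ℝ) : ℂ))) := by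
    rw [← intervalIntegral_integral_swap]
    · exact intervalIntegral.integral_congr fun φ _ => e1 φ
    · have i1 : Integrable (fun Y : W4 => B (Y, n)) := (sliceL B n).integrable
      have i2 : Integrable (fun φ : ℝ => (1:ℂ)) (volume.restrict (Set.uIoc 0 (2 * Real.pi))) := by
        rw [Set.uIoc_of_le (by positivity)]
        apply integrable_const
      have i3 := i2.mul_prod i1
      refine (i3.mul_bdd (c := 1) (g := fun q : ℝ × W4 => cexp (-(I * ((2 * Real.pi * (cexp (q.1 * I) * (starRingEnd ℂ q.2.fst * z + starRingEnd ℂ q.2.snd * w)).re : ℝ) : ℂ)))) ?_ ?_).congr ?_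
      · apply Continuous.aestronglyMeasurable
        have h1 := tg_w1.1.continuous
        have h2 := tg_w2.1.continuous
        fun_prop
      · filter_upwards with σ
        rw [norm_osc_exp]
      · filter_upwards with σ
        simp [Function.uncurry]
  rw [e3] at e2
  rw [eq_inv_smul_iff₀ (by positivity), ← e2]
  refine integral_congr_ae (Filter.Eventually.of_forall fun Y => ?_)
  simp only [intervalIntegral.integral_const_mul]
  ring

lemma schwarz_plane (G : SchwartzMap (ℂ × ℂ) ℂ) (hr : ∀ (φ : ℝ) (z w : ℂ), G (cexp (φ * I) * z, cexp (φ * I) * w) = G (z, w)) 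
    (hs : ∀ z w, G (starRingEnd ℂ z, starRingEnd ℂ w) = G (z, w)) : 
    ∃ Φ : SchwartzMap (ℝ × ℝ × ℝ) ℂ, ∀ z w, G (z, w) = Φ (sqP z, sqP w, reP z w) := by
  obtain ⟨Ψ, hΨ⟩ := stage1 G hr
  obtain ⟨Φ, hΦ⟩ := stage2 Ψ
  refine ⟨Φ, fun z w => ?_⟩
  rw [hΦ (imP z w)]
  · have h1 := hΨ z w
    have h2 := hΨ (starRingEnd ℂ z) (starRingEnd ℂ w)
    have : PP (starRingEnd ℂ z) (starRingEnd ℂ w) = (- imP z w, sqP z, sqP w, reP z w) := by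
      simp [PP, imP, sqP, reP]; ring
    rw [hs, this] at h2
    rw [← h2, show (imP z w, sqP z, sqP w, reP z w) = PP z w from rfl, ← h1]
    ring
  · unfold sqP reP imP; ring

abbrev E3 := EuclideanSpace ℝ (Fin 3)
abbrev E6 := WithLp 2 (E3 × E3)

def e6 : E6 ≃L[ℝ] V3 × V3 := (WithLp.prodContinuousLinearEquiv 2 ℝ E3 E3).trans 
  ((PiLp.continuousLinearEquiv 2 ℝ (fun _ : Fin 3 => ℝ)).prodCongr (PiLp.continuousLinearEquiv 2 ℝ (fun _ : Fin 3 => ℝ)))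

lemma e6_mp : MeasurePreserving (e6 : E6 → V3 × V3) := by
  have h1 := WithLp.volume_preserving_ofLp E3 E3
  have h2 := (PiLp.volume_preserving_ofLp (Fin 3)).prod (PiLp.volume_preserving_ofLp (Fin 3))
  exact h2.comp h1

def lin6 : ℂ × ℂ →ₗ[ℝ] V3 × V3 where
  toFun z := (2 * Real.pi)⁻¹ • (![z.1.re, 0, z.1.im], ![z.2.re, 0, z.2.im])
  map_add' z w := by
    rw [← smul_add]
    congr 1
    simp 
  map_smul' c z := by
    rw [RingHom.id_apply, smul_comm]
    congr 1
    simp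

lemma lin6_inj : Function.Injective lin6 := by
  intro z w h
  have hpi : (2 * Real.pi)⁻¹ ≠ 0 := by positivity
  have h1 := (smul_right_injective (V3 × V3) hpi h)
  rw [Prod.mk.injEq] at h1
  have a0 := congrFun h1.1 0
  have a2 := congrFun h1.1 2
  have b0 := congrFun h1.2 0
  have b2 := congrFun h1.2 2
  simp at a0 a2 b0 b2
  exact Prod.ext (Complex.ext a0 a2) (Complex.ext b0 b2)

def ph (z w : ℂ) (p : V3 × V3) : ℝ := z.re * p.1 0 + z.im * p.1 2 + (w.re * p.2 0 + w.im * p.2 2)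

open FourierTransform in
lemma planeG0 (F : SchwartzMap (V3 × V3) ℂ) : ∃ G : SchwartzMap (V3 × V3) ℂ, ∀ q, 
    G q = ∫ p : V3 × V3, F p * cexp (I * ((2 * Real.pi * (p.1 ⬝ᵥ q.1 + p.2 ⬝ᵥ q.2) : ℝ) : ℂ)) := by
  let F' : SchwartzMap E6 ℂ := SchwartzMap.compCLMOfContinuousLinearEquiv ℝ e6 F
  refine ⟨SchwartzMap.compCLMOfContinuousLinearEquiv ℝ e6.symm (𝓕⁻ F'), fun q => ?_⟩
  show (𝓕⁻ F') (e6.symm q) = _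
  rw [SchwartzMap.fourierInv_coe, Real.fourierInv_eq', 
    ← e6_mp.integral_comp e6.toHomeomorph.measurableEmbedding]
  refine integral_congr_ae (Filter.Eventually.of_forall fun Y => ?_)
  show cexp _ • F (e6 Y) = F (e6 Y) * _
  rw [smul_eq_mul, mul_comm]
  congr 2
  rw [mul_comm I]
  congr 4
  rw [WithLp.prod_inner_apply]
  simp [PiLp.inner_apply, Fin.sum_univ_three, e6, dotProduct]
  ring

lemma planeG (F : SchwartzMap (V3 × V3) ℂ) : ∃ G : SchwartzMap (ℂ × ℂ) ℂ, ∀ z w, 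
    G (z, w) = ∫ p : V3 × V3, F p * cexp (I * (ph z w p : ℝ)) := by
  obtain ⟨G, hG⟩ := planeG0 F
  obtain ⟨K, hK, hK2⟩ := lin6.exists_antilipschitzWith (LinearMap.ker_eq_bot.mpr lin6_inj)
  have htg : (fun z => lin6 z).HasTemperateGrowth := (LinearMap.toContinuousLinearMap lin6).hasTemperateGrowth
  refine ⟨SchwartzMap.compCLMOfAntilipschitz ℝ htg hK2 G, fun z w => ?_⟩
  show G (lin6 (z, w)) = _
  rw [hG]
  congr 1
  ext p
  congr 4
  rw [show lin6 (z, w) = (2 * Real.pi)⁻¹ • (![z.re, 0, z.im], ![w.re, 0, w.im]) from rfl]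
  simp [Fin.sum_univ_three, ph, dotProduct]
  field_simp

lemma so3_dmp {k : Mat3} (hk : k ∈ SO3) : MeasurePreserving (fun p : V3 × V3 => (k.mulVec p.1, k.mulVec p.2)) := by
  have h1 : MeasurePreserving (fun x : V3 => k.mulVec x) := by
    refine ⟨by fun_prop, ?_⟩
    have h := Real.map_matrix_volume_pi_eq_smul_volume_pi (M := k) (by rw [hk.2]; exact one_ne_zero)
    rw [hk.2] at h
    simp at h
    exact h
  exact h1.prod h1

lemma so3_cv {k : Mat3} (hk : k ∈ SO3) (H : V3 × V3 → ℂ) : 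
   ∫ p : V3 × V3, H (k.mulVec p.1, k.mulVec p.2) = ∫ p, H p := by
  have hu : IsUnit k := by rw [Matrix.isUnit_iff_isUnit_det, hk.2]; exact isUnit_one
  have hinj := Matrix.mulVec_injective_of_isUnit hu
  refine (so3_dmp hk).integral_comp (Continuous.measurableEmbedding (by fun_prop) ?_) H
  intro p q h
  simp only [Prod.mk.injEq] at h
  exact Prod.ext (hinj h.1) (hinj h.2)

/-- rotate -/
lemma planeInv (F : SchwartzMap (V3 × V3) ℂ) (hF : Inv3 F) {k : Mat3} (hk : k ∈ SO3) (e : V3 × V3 → ℂ) :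
   ∫ p : V3 × V3, F p * e p = ∫ p : V3 × V3, F p * e (k.mulVec p.1, k.mulVec p.2) := by
  rw [← so3_cv hk (fun p => F p * e p)]
  refine integral_congr_ae (Filter.Eventually.of_forall fun p => ?_)
  simp only
  rw [hF k hk]

def rot02 (φ : ℝ) : Mat3 := !![Real.cos φ, 0, Real.sin φ; 0, 1, 0; -Real.sin φ, 0, Real.cos φ]
def rot01 (φ : ℝ) : Mat3 := !![Real.cos φ, Real.sin φ, 0; -Real.sin φ, Real.cos φ, 0; 0, 0, 1]
def refl2 : Mat3 := !![1, 0, 0; 0, -1, 0; 0, 0, -1]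
lemma rot02_mem (φ) : rot02 φ ∈ SO3 := by
  have := Real.sin_sq_add_cos_sq φ
  refine ⟨?_, ?_⟩
  · ext i j
    fin_cases i <;> fin_cases j <;> simp [rot02, Matrix.mul_apply, Fin.sum_univ_three] <;> nlinarith
  · simp [rot02, Matrix.det_fin_three]; nlinarith
lemma rot01_mem (φ) : rot01 φ ∈ SO3 := by
  have := Real.sin_sq_add_cos_sq φ
  refine ⟨?_, ?_⟩
  · ext i j
    fin_cases i <;> fin_cases j <;> simp [rot01, Matrix.mul_apply, Fin.sum_univ_three] <;> nlinarith
  · simp [rot01, Matrix.det_fin_three]; nlinarith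
lemma refl2_mem : refl2 ∈ SO3 := by
  refine ⟨?_, ?_⟩
  · ext i j
    fin_cases i <;> fin_cases j <;> simp [refl2, Matrix.mul_apply, Fin.sum_univ_three] 
  · simp [refl2, Matrix.det_fin_three]

lemma stepPhi (F : SchwartzMap (V3 × V3) ℂ) (hF : Inv3 F) : ∃ Φ : SchwartzMap (ℝ × ℝ × ℝ) ℂ, 
   (∀ a b r lam : ℝ, ∫ p : V3 × V3, F p * cexp (I * ((a * p.1 0 + b * p.1 1 + r * p.1 2 + lam * p.2 2 : ℝ) : ℂ)) 
      = Φ (a ^ 2 + b ^ 2 + r ^ 2, lam ^ 2, lam * r)) := by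
  obtain ⟨G, hG⟩ := planeG F
  obtain ⟨Φ, hΦ⟩ := schwarz_plane G (by
    intro φ z w
    rw [hG, hG, planeInv F hF (rot02_mem (-φ))]
    congr 1
    ext p
    congr 4
    simp [ph, rot02, Matrix.mulVec, dotProduct, Fin.sum_univ_three, Complex.exp_ofReal_mul_I_re, Complex.exp_ofReal_mul_I_im]
    linear_combination (z.re * p.1 0 + z.im * p.1 2 + (w.re * p.2 0 + w.im * p.2 2)) * Real.sin_sq_add_cos_sq φ) (by
    intro z w
    rw [hG, hG, planeInv F hF refl2_mem]
    congr 1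
    ext p
    congr 4
    simp [ph, refl2, Matrix.mulVec, dotProduct, Fin.sum_univ_three])
  refine ⟨Φ, fun a b r lam => ?_⟩
  let ζ : ℂ := ⟨a, b⟩
  have h1 := hΦ ⟨‖ζ‖, r⟩ ⟨0, lam⟩
  have h2 : ‖ζ‖ ^ 2 = a ^ 2 + b ^ 2 := by
    rw [← Complex.normSq_eq_norm_sq, Complex.normSq_apply]; simp [ζ]; ring
  have ha : ‖ζ‖ * Real.cos (arg ζ) = a := Complex.norm_mul_cos_arg ζ
  have hb : ‖ζ‖ * Real.sin (arg ζ) = b := Complex.norm_mul_sin_arg ζ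
  simp only [sqP, reP, h2] at h1
  rw [show a ^ 2 + b ^ 2 + r ^ 2 = a ^ 2 + b ^ 2 + r ^ 2 from rfl]
  have h3 : (a ^ 2 + b ^ 2 + r ^ 2, lam ^ 2, lam * r) = (a ^ 2 + b ^ 2 + r ^ 2, (0:ℝ) ^ 2 + lam ^ 2, ‖ζ‖ * 0 + r * lam) := by
    simp [mul_comm]
  rw [h3, ← h1, hG]
  symm
  rw [planeInv F hF (rot01_mem (arg ζ))]
  congr 1
  ext p
  congr 4
  simp [ph, rot01, Matrix.mulVec, dotProduct, Fin.sum_univ_three]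
  linear_combination (p.1 0) * ha + p.1 1 * hb

lemma lag_eq (l : ℕ) (u : ℝ) : lag l u = 
    ∑ k ∈ Finset.range (l + 1), (l.choose k : ℝ) * (-u) ^ k / k.factorial * Real.exp (-(u / 2)) := by
  unfold lag
  rw [← iteratedDeriv_eq_iterate]
  have h := iteratedDeriv_mul (n := l) (x := u) (f := fun v : ℝ => v ^ l) (g := fun v : ℝ => Real.exp (-v)) 
    (by fun_prop) (by fun_prop)
  have h0 : (fun v : ℝ => v ^ l * Real.exp (-v)) = (fun v : ℝ => v ^ l) * (fun v : ℝ => Real.exp (-v)) := rfl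
  rw [h0, h, ← Finset.sum_range_reflect, Finset.mul_sum]
  refine Finset.sum_congr rfl fun k hk => ?_
  have hk' : k ≤ l := by simpa [Nat.lt_succ_iff] using hk
  rw [show l + 1 - 1 - k = l - k by omega, show l - (l - k) = k by omega, iteratedDeriv_pow, 
    iteratedDeriv_comp_neg, iteratedDeriv_eq_iterate, Real.iter_deriv_exp,
    show l - (l - k) = k by omega, Nat.choose_symm hk']
  have h1 : ((l.descFactorial (l - k) : ℕ) : ℝ) = l.factorial / k.factorial := by
    rw [Nat.descFactorial_eq_div (Nat.sub_le _ _), show l - (l - k) = k by omega, 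
      Nat.cast_div (Nat.factorial_dvd_factorial hk') (by positivity)]
  rw [h1, neg_pow u k]
  have h2 : Real.exp (-u) = Real.exp (-(u/2)) * Real.exp (-(u/2)) := by rw [← Real.exp_add]; congr 1; ring
  have h3 : Real.exp (u/2) * Real.exp (-(u/2)) = 1 := by rw [← Real.exp_add]; simp
  have : (l.factorial : ℝ) ≠ 0 := by positivity
  have : (k.factorial : ℝ) ≠ 0 := by positivity
  rw [h2, smul_eq_mul]
  field_simp
  linear_combination (l.choose k : ℝ) * u ^ k * h3

lemma lag_bdd (l : ℕ) : ∃ C : ℝ, ∀ u ≥ 0, |lag l u| ≤ C := by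
  refine ⟨∑ k ∈ Finset.range (l + 1), (l.choose k : ℝ) * 2 ^ k, fun u hu => ?_⟩
  rw [lag_eq]
  refine (Finset.abs_sum_le_sum_abs _ _).trans (Finset.sum_le_sum fun k _ => ?_)
  rw [abs_mul, abs_div, abs_mul, abs_pow, abs_neg, abs_of_nonneg hu, Real.abs_exp, abs_of_nonneg (by positivity : (0:ℝ) ≤ l.choose k), 
    abs_of_nonneg (by positivity : (0:ℝ) ≤ k.factorial)]
  have h := Real.pow_div_factorial_le_exp (u / 2) (by positivity) k
  have h2 : Real.exp (u/2) * Real.exp (-(u/2)) = 1 := by rw [← Real.exp_add]; simp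
  have h3 : u ^ k = 2 ^ k * (u / 2) ^ k := by rw [← mul_pow]; congr 1; ring
  rw [h3]
  calc _ = (l.choose k : ℝ) * 2 ^ k * (((u/2)^k / k.factorial) * Real.exp (-(u/2))) := by ring
    _ ≤ (l.choose k : ℝ) * 2 ^ k * (Real.exp (u/2) * Real.exp (-(u/2))) := by gcongr
    _ = _ := by rw [h2, mul_one]

lemma lag_cont (l : ℕ) : Continuous (lag l) := by
  have : lag l = _ := funext (lag_eq l)
  rw [this]
  fun_prop

instance : BorelSpace Mat3 := (inferInstance : BorelSpace (Fin 3 → Fin 3 → ℝ))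
instance : SecondCountableTopology Mat3 := (inferInstance : SecondCountableTopology (Fin 3 → Fin 3 → ℝ))

instance : (volume : Measure (V3 × V3)).IsAddHaarMeasure := 
  Measure.prod.instIsAddHaarMeasure (volume : Measure V3) (volume : Measure V3)

lemma swap_bdd {X Y : Type*} [MeasurableSpace X] [MeasurableSpace Y] (μ : Measure X) (ν : Measure Y) [SFinite μ] [SFinite ν]
    (f : X → ℂ) (hf : Integrable f μ) (g : Y → ℂ) (hg : Integrable g ν) (h : X → Y → ℂ) (C : ℝ)
    (hm : AEStronglyMeasurable (Function.uncurry h) (μ.prod ν)) (hb : ∀ x y, ‖h x y‖ ≤ C) : 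
    ∫ x, ∫ y, f x * g y * h x y ∂ν ∂μ = ∫ y, ∫ x, f x * g y * h x y ∂μ ∂ν := by
  refine integral_integral_swap ?_
  exact (hf.mul_prod hg).mul_bdd hm (Filter.Eventually.of_forall fun q => hb q.1 q.2)

def hfun (lam : ℝ) (l : ℕ) (r : ℝ) (p : V3 × V3) : ℂ := 
  cexp (I * ((lam * p.2 2 + r * p.1 2 : ℝ) : ℂ)) * (lag l (lam / 2 * (p.1 0 ^ 2 + p.1 1 ^ 2)) : ℝ)

lemma redA (μ : Measure Mat3) (hμ : IsHaarSO3 μ) (F : SchwartzMap (V3 × V3) ℂ) (hF : Inv3 ⇑F) 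
    (lam : ℝ) (hlam : 0 < lam) (l : ℕ) (r : ℝ) : 
    ∫ p : V3 × V3, F p * (starRingEnd ℂ) (sph μ lam l r p.1 p.2) = ∫ p : V3 × V3, F p * hfun lam l r p := by
  obtain ⟨hp, hc, _⟩ := hμ
  obtain ⟨C, hC⟩ := lag_bdd l
  have hcont := lag_cont l
  have e1 : ∀ p : V3 × V3, F p * (starRingEnd ℂ) (sph μ lam l r p.1 p.2) = 
     ∫ k, F p * 1 * hfun lam l r (k.mulVec p.1, k.mulVec p.2) ∂μ := by
    intro p
    rw [integral_const_mul, mul_one]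
    congr 1
    unfold sph
    rw [← integral_conj]
    congr 1
    ext k
    simp only [map_mul, ← Complex.exp_conj, Complex.conj_ofReal, map_neg, Complex.conj_I, hfun]
    rw [mul_right_comm, ← Complex.exp_add]
    congr 2
    push_cast; ring
  simp only [e1]
  rw [swap_bdd (μ := volume) (ν := μ) (C := C) (f := F) (hf := F.integrable) (g := fun _ => 1) (hg := integrable_const _)
    (h := fun p k => hfun lam l r (k.mulVec p.1, k.mulVec p.2))]
  · have : ∀ᵐ k ∂μ, ∫ p : V3 × V3, F p * 1 * hfun lam l r (k.mulVec p.1, k.mulVec p.2) = ∫ p : V3 × V3, F p * hfun lam l r p := by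
      have h0 : ∀ᵐ k ∂μ, k ∈ SO3 := by rw [ae_iff]; exact hc
      filter_upwards [h0] with k hk
      rw [planeInv F hF hk]
      simp
    rw [integral_congr_ae this]
    simp
  · apply Continuous.aestronglyMeasurable
    unfold hfun Function.uncurry
    fun_prop
  · intro p k
    unfold hfun
    rw [norm_mul, mul_comm I, Complex.norm_exp_ofReal_mul_I, one_mul, Complex.norm_real]
    exact hC _ (by positivity)

lemma gauss2 (b : ℂ) (hb : 0 < b.re) (t1 t2 : ℝ) : ∫ q : ℝ × ℝ, cexp (I * ((q.1 * t1 + q.2 * t2 : ℝ) : ℂ)) * cexp (-b * ((q.1^2 + q.2^2 : ℝ) : ℂ)) 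
    = Real.pi / b * cexp (-((t1 ^ 2 + t2 ^ 2 : ℝ) : ℂ) / (4 * b)) := by
  have h1 := fourierIntegral_gaussian hb t1
  have h2 := fourierIntegral_gaussian hb t2
  have h3 := integral_prod_mul (μ := (volume : Measure ℝ)) (ν := (volume : Measure ℝ)) (fun x : ℝ => cexp (I * t1 * x) * cexp (-b * x ^ 2)) 
     (fun x : ℝ => cexp (I * t2 * x) * cexp (-b * x ^ 2))
  rw [h1, h2] at h3
  have h4 : ((Real.pi : ℂ) / b) ^ (1/2 : ℂ) * ((Real.pi : ℂ) / b) ^ (1/2 : ℂ) = Real.pi / b := by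
    have hb0 : b ≠ 0 := by intro h; simp [h] at hb
    rw [← Complex.cpow_add _ _ (div_ne_zero (by exact_mod_cast Real.pi_ne_zero) hb0)]
    norm_num
  rw [mul_mul_mul_comm, h4, ← Complex.exp_add] at h3
  refine Eq.trans (integral_congr_ae (Filter.Eventually.of_forall fun q => ?_)) (h3.trans ?_)
  · simp only
    rw [← Complex.exp_add, ← Complex.exp_add, ← Complex.exp_add, ← Complex.exp_add]
    congr 1; push_cast; ring
  · congr 2; push_cast; ring

lemma gauss2_int (b : ℂ) (hb : 0 < b.re) : Integrable (fun q : ℝ × ℝ => cexp (-b * ((q.1^2 + q.2^2 : ℝ) : ℂ))) := by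
  have h := (integrable_cexp_neg_mul_sq hb).mul_prod (integrable_cexp_neg_mul_sq hb)
  refine h.congr (Filter.Eventually.of_forall fun q => ?_)
  simp only
  rw [← Complex.exp_add]
  congr 1; push_cast; ring

lemma M0 (F : SchwartzMap (V3 × V3) ℂ) (Φ B : SchwartzMap (ℝ × ℝ × ℝ) ℂ) 
   (hΦ : ∀ a b r lam : ℝ, ∫ p : V3 × V3, F p * cexp (I * ((a * p.1 0 + b * p.1 1 + r * p.1 2 + lam * p.2 2 : ℝ) : ℂ)) 
      = Φ (a ^ 2 + b ^ 2 + r ^ 2, lam ^ 2, lam * r))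
   (hB : ∀ t p, Φ (t, p) = ∫ τ : ℝ, B (τ, p) * cexp (-(I * ((τ * t : ℝ) : ℂ)))) (lam r α : ℝ) (hα : 0 < α) : 
   ∫ p : V3 × V3, F p * (cexp (I * ((lam * p.2 2 + r * p.1 2 : ℝ) : ℂ)) * cexp (-((α * (p.1 0 ^ 2 + p.1 1 ^ 2) : ℝ) : ℂ))) = 
   ∫ τ : ℝ, (B (τ, lam ^ 2, lam * r) * cexp (-(I * ((τ * r ^ 2 : ℝ) : ℂ)))) * (1 / (1 + 4 * I * τ * α)) := by
  have hpi : (Real.pi : ℂ) ≠ 0 := by exact_mod_cast Real.pi_ne_zero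
  have hα' : (α : ℂ) ≠ 0 := by exact_mod_cast hα.ne'
  let b0 : ℂ := ((1 / (4 * α) : ℝ) : ℂ)
  have hb0 : 0 < b0.re := by simp only [b0, ofReal_re]; positivity
  let g : ℝ × ℝ → ℂ := fun q => cexp (-b0 * ((q.1^2 + q.2^2 : ℝ) : ℂ))
  have hg : Integrable g := gauss2_int b0 hb0
  have e1 : ∀ p : V3 × V3, ∫ q : ℝ × ℝ, F p * g q * cexp (I * ((q.1 * p.1 0 + q.2 * p.1 1 + r * p.1 2 + lam * p.2 2 : ℝ) : ℂ)) = 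
     (4 * Real.pi * α) * (F p * (cexp (I * ((lam * p.2 2 + r * p.1 2 : ℝ) : ℂ)) * cexp (-((α * (p.1 0 ^ 2 + p.1 1 ^ 2) : ℝ) : ℂ)))) := by
    intro p
    have h := gauss2 b0 hb0 (p.1 0) (p.1 1)
    calc _ = ∫ q : ℝ × ℝ, (F p * cexp (I * ((lam * p.2 2 + r * p.1 2 : ℝ) : ℂ))) * (cexp (I * ((q.1 * p.1 0 + q.2 * p.1 1 : ℝ) : ℂ)) * cexp (-b0 * ((q.1^2 + q.2^2 : ℝ) : ℂ))) := by
          congr 1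
          ext q
          rw [show I * ((q.1 * p.1 0 + q.2 * p.1 1 + r * p.1 2 + lam * p.2 2 : ℝ) : ℂ) = I * ((lam * p.2 2 + r * p.1 2 : ℝ) : ℂ) + I * ((q.1 * p.1 0 + q.2 * p.1 1 : ℝ) : ℂ) by push_cast; ring, Complex.exp_add]
          ring
      _ = _ := by
          rw [integral_const_mul, h]
          have : -((p.1 0 ^ 2 + p.1 1 ^ 2 : ℝ) : ℂ) / (4 * b0) = -((α * (p.1 0 ^ 2 + p.1 1 ^ 2) : ℝ) : ℂ) := by
            simp only [b0]; push_cast; field_simp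
          rw [this]
          have : (Real.pi : ℂ) / b0 = 4 * Real.pi * α := by simp only [b0]; push_cast; field_simp
          rw [this]; ring
  have e2 : (4 * Real.pi * α) * (∫ p : V3 × V3, F p * (cexp (I * ((lam * p.2 2 + r * p.1 2 : ℝ) : ℂ)) * cexp (-((α * (p.1 0 ^ 2 + p.1 1 ^ 2) : ℝ) : ℂ)))) = 
      ∫ q : ℝ × ℝ, g q * Φ (q.1 ^ 2 + q.2 ^ 2 + r ^ 2, lam ^ 2, lam * r) := by
    rw [← integral_const_mul]
    simp only [← e1]
    rw [swap_bdd volume volume F F.integrable g hg (fun p q => cexp (I * ((q.1 * p.1 0 + q.2 * p.1 1 + r * p.1 2 + lam * p.2 2 : ℝ) : ℂ))) 1]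
    · congr 1
      ext q
      rw [← hΦ, ← integral_const_mul]
      congr 1
      ext p
      ring
    · apply Continuous.aestronglyMeasurable
      unfold Function.uncurry
      fun_prop
    · intro p q
      rw [mul_comm I, Complex.norm_exp_ofReal_mul_I]
  have e3 : ∀ q : ℝ × ℝ, g q * Φ (q.1 ^ 2 + q.2 ^ 2 + r ^ 2, lam ^ 2, lam * r) = 
     ∫ τ : ℝ, g q * B (τ, lam ^ 2, lam * r) * cexp (-(I * ((τ * (q.1 ^ 2 + q.2 ^ 2 + r ^ 2) : ℝ) : ℂ))) := by
    intro q
    rw [hB, ← integral_const_mul]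
    congr 1
    ext τ
    ring
  have hBi : Integrable (fun τ : ℝ => B (τ, lam ^ 2, lam * r)) := (sliceL B (lam ^ 2, lam * r)).integrable
  simp only [e3] at e2
  rw [swap_bdd volume volume g hg (fun τ : ℝ => B (τ, lam ^ 2, lam * r)) hBi (fun q τ => cexp (-(I * ((τ * (q.1 ^ 2 + q.2 ^ 2 + r ^ 2) : ℝ) : ℂ)))) 1] at e2
  · have h4 : (4 * Real.pi * α : ℂ) ≠ 0 := mul_ne_zero (mul_ne_zero (by norm_num) hpi) hα'
    apply mul_left_cancel₀ h4
    rw [e2, ← integral_const_mul]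
    congr 1
    ext τ
    let b1 : ℂ := b0 + I * τ
    have hb1 : 0 < b1.re := by simpa [b1] using hb0
    have h := gauss2 b1 hb1 0 0
    calc _ = ∫ q : ℝ × ℝ, (B (τ, lam ^ 2, lam * r) * cexp (-(I * ((τ * r ^ 2 : ℝ) : ℂ)))) * (cexp (I * ((q.1 * 0 + q.2 * 0 : ℝ) : ℂ)) * cexp (-b1 * ((q.1^2 + q.2^2 : ℝ) : ℂ))) := by
          congr 1
          ext q
          have : g q * cexp (-(I * ((τ * (q.1 ^ 2 + q.2 ^ 2 + r ^ 2) : ℝ) : ℂ))) = cexp (-(I * ((τ * r ^ 2 : ℝ) : ℂ))) * (cexp (I * ((q.1 * 0 + q.2 * 0 : ℝ) : ℂ)) * cexp (-b1 * ((q.1^2 + q.2^2 : ℝ) : ℂ))) := by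
            simp only [g, b1]
            rw [← Complex.exp_add, ← Complex.exp_add, ← Complex.exp_add]
            congr 1
            push_cast; ring
          linear_combination B (τ, lam ^ 2, lam * r) * this
      _ = _ := by
          rw [integral_const_mul, h]
          have hb2 : b1 ≠ 0 := by intro h; simp [h] at hb1
          have h5 : 4 * α * b1 = 1 + 4 * I * τ * α := by simp only [b1, b0]; push_cast; field_simp
          rw [← h5]
          simp
          field_simp
  · apply Continuous.aestronglyMeasurable
    unfold Function.uncurry
    fun_prop
  · intro p q
    rw [norm_osc_exp]

lemma norm_den (x : ℝ) : 1 ≤ ‖(1 + I * x : ℂ)‖ := by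
  have := Complex.abs_re_le_norm (1 + I * x : ℂ)
  simpa using this

lemma Mj_deriv {X : Type*} [MeasurableSpace X] (μ : Measure X) (f : X → ℂ) (s : X → ℝ) (hs0 : ∀ x, 0 ≤ s x) 
   (hm : AEStronglyMeasurable s μ)
   (hf : ∀ j : ℕ, Integrable (fun x => f x * (s x : ℂ) ^ j) μ) (j : ℕ) (α : ℝ) (hα : 0 < α) : 
   HasDerivAt (fun α : ℝ => ∫ x, (f x * (s x : ℂ) ^ j) * cexp (-((α * s x : ℝ) : ℂ)) ∂μ) 
     (- ∫ x, (f x * (s x : ℂ) ^ (j + 1)) * cexp (-((α * s x : ℝ) : ℂ)) ∂μ) α := by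
  have hexp : ∀ a : ℝ, AEStronglyMeasurable (fun x => cexp (-((a * s x : ℝ) : ℂ))) μ := by
    intro a
    have : Continuous (fun y : ℝ => cexp (-((a * y : ℝ) : ℂ))) := by fun_prop
    exact this.comp_aestronglyMeasurable hm
  have hle : ∀ a > 0, ∀ x, ‖cexp (-((a * s x : ℝ) : ℂ))‖ ≤ 1 := by
    intro a ha x
    rw [← Complex.ofReal_neg, Complex.norm_exp_ofReal, Real.exp_le_one_iff]
    have := mul_nonneg ha.le (hs0 x)
    linarith
  have h := hasDerivAt_integral_of_dominated_loc_of_deriv_le (μ := μ) (𝕜 := ℝ) (s := Set.Ioi 0) (x₀ := α)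
    (F := fun α x => (f x * (s x : ℂ) ^ j) * cexp (-((α * s x : ℝ) : ℂ))) (bound := fun x => ‖f x * (s x : ℂ) ^ (j+1)‖)
    (F' := fun α x => - ((f x * (s x : ℂ) ^ (j + 1)) * cexp (-((α * s x : ℝ) : ℂ)))) (Ioi_mem_nhds hα) 
    (Filter.Eventually.of_forall fun a => (hf j).1.mul (hexp a)) ((hf j).mul_bdd (hexp α) (Filter.Eventually.of_forall (hle α hα)))
    ((hf (j+1)).1.mul (hexp α)).neg (Filter.Eventually.of_forall fun x a ha => ?_) (hf (j+1)).norm 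
    (Filter.Eventually.of_forall fun x a ha => ?_)
  · have h2 := h.2
    rw [integral_neg] at h2
    exact h2
  · rw [norm_neg, norm_mul]
    exact mul_le_of_le_one_right (norm_nonneg _) (hle a ha x)
  · have h1 : HasDerivAt (fun a : ℝ => (((a * s x : ℝ)) : ℂ)) ((s x : ℝ) : ℂ) a := by
      have := ((hasDerivAt_id a).mul_const (s x)).ofReal_comp
      simpa using this
    refine (h1.neg.cexp.const_mul (f x * (s x : ℂ) ^ j)).congr_deriv ?_
    simp only [Pi.neg_apply]
    ring

lemma Nj_deriv (b : ℝ → ℂ) 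
   (hf : ∀ j : ℕ, Integrable (fun τ : ℝ => b τ * (τ : ℂ) ^ j)) (j : ℕ) (α : ℝ) : 
   HasDerivAt (fun α : ℝ => ∫ τ : ℝ, (b τ * (τ : ℂ) ^ j) * (j.factorial * (4 * I) ^ j / (1 + 4 * I * τ * α) ^ (j + 1))) 
     (- ∫ τ : ℝ, (b τ * (τ : ℂ) ^ (j + 1)) * ((j+1).factorial * (4 * I) ^ (j+1) / (1 + 4 * I * τ * α) ^ (j + 2))) α := by
  have hd : ∀ (a τ : ℝ), 1 ≤ ‖(1 + 4 * I * τ * a : ℂ)‖ := by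
    intro a τ
    have := norm_den (4 * τ * a)
    push_cast at this
    rwa [show (1 + 4 * I * τ * a : ℂ) = 1 + I * (4 * τ * a) by ring]
  have hd0 : ∀ (a τ : ℝ), (1 + 4 * I * τ * a : ℂ) ≠ 0 := by
    intro a τ h
    have := hd a τ
    rw [h] at this; norm_num at this
  have hc : ∀ (a : ℝ) (m n : ℕ), AEStronglyMeasurable (fun τ : ℝ => (m.factorial * (4 * I) ^ m / (1 + 4 * I * τ * a) ^ n)) := by
    intro a m n
    apply Continuous.aestronglyMeasurable
    exact Continuous.div (by fun_prop) (by fun_prop) (fun τ => pow_ne_zero _ (hd0 a τ))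
  have hle : ∀ (a τ : ℝ) (m n : ℕ), ‖((m.factorial : ℂ) * (4 * I) ^ m / (1 + 4 * I * τ * a) ^ n)‖ ≤ m.factorial * 4 ^ m := by
    intro a τ m n
    rw [norm_div, norm_mul, norm_pow, norm_pow, norm_mul, Complex.norm_I, Complex.norm_natCast]
    refine (div_le_self (by positivity) (one_le_pow₀ (hd a τ))).trans ?_
    simp
  have h := hasDerivAt_integral_of_dominated_loc_of_deriv_le (μ := (volume : Measure ℝ)) (𝕜 := ℝ) (s := Set.univ) (x₀ := α)
    (F := fun α τ => (b τ * (τ : ℂ) ^ j) * (j.factorial * (4 * I) ^ j / (1 + 4 * I * τ * α) ^ (j + 1))) 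
    (bound := fun τ => ‖b τ * (τ : ℂ) ^ (j+1)‖ * ((j+1).factorial * 4 ^ (j+1)))
    (F' := fun α τ => - ((b τ * (τ : ℂ) ^ (j + 1)) * ((j+1).factorial * (4 * I) ^ (j+1) / (1 + 4 * I * τ * α) ^ (j + 2)))) (Filter.univ_mem) 
    (Filter.Eventually.of_forall fun a => (hf j).1.mul (hc a j (j+1))) ((hf j).mul_bdd (hc α j (j+1)) (Filter.Eventually.of_forall fun τ => hle α τ j (j+1)))
    ((hf (j+1)).1.mul (hc α (j+1) (j+2))).neg (Filter.Eventually.of_forall fun x a ha => ?_) ((hf (j+1)).norm.mul_const _) 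
    (Filter.Eventually.of_forall fun x a ha => ?_)
  · have h2 := h.2
    rw [integral_neg] at h2
    exact h2
  · rw [norm_neg, norm_mul]
    exact mul_le_mul_of_nonneg_left (hle a x (j+1) (j+2)) (norm_nonneg _)
  · have h1 : HasDerivAt (fun a : ℝ => (1 + 4 * I * x * (a : ℂ))) (4 * I * x) a := by
      have := ((hasDerivAt_id a).ofReal_comp.const_mul (4 * I * x)).const_add 1
      simpa using this
    have h2 := ((h1.pow (j+1)).inv (pow_ne_zero _ (hd0 a x))).const_mul ((b x * (x : ℂ) ^ j) * (j.factorial * (4 * I) ^ j))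
    refine (h2.congr_of_eventuallyEq (Filter.Eventually.of_forall fun a' => ?_)).congr_deriv ?_
    · simp only [Pi.pow_apply, Pi.inv_apply]
      ring
    · have := hd0 a x
      rw [Nat.factorial_succ]
      push_cast
      simp only [Pi.pow_apply]
      field_simp
      simp
      ring

lemma MN {X : Type*} [MeasurableSpace X] (μ : Measure X) (f : X → ℂ) (s : X → ℝ) (hs0 : ∀ x, 0 ≤ s x) 
   (hm : AEStronglyMeasurable s μ)
   (hf : ∀ j : ℕ, Integrable (fun x => f x * (s x : ℂ) ^ j) μ) 
   (b : ℝ → ℂ) (hb : ∀ j : ℕ, Integrable (fun τ : ℝ => b τ * (τ : ℂ) ^ j)) 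
   (h0 : ∀ α : ℝ, 0 < α → ∫ x, f x * cexp (-((α * s x : ℝ) : ℂ)) ∂μ = ∫ τ : ℝ, b τ * (1 / (1 + 4 * I * τ * α))) (j : ℕ) : 
   ∀ α : ℝ, 0 < α → ∫ x, (f x * (s x : ℂ) ^ j) * cexp (-((α * s x : ℝ) : ℂ)) ∂μ = 
     ∫ τ : ℝ, (b τ * (τ : ℂ) ^ j) * (j.factorial * (4 * I) ^ j / (1 + 4 * I * τ * α) ^ (j + 1)) := by
  induction j with
  | zero => 
    intro α hα
    simpa using h0 α hα
  | succ j ih =>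
    intro α hα
    have h1 := Mj_deriv μ f s hs0 hm hf j α hα
    have h2 := Nj_deriv b hb j α
    have h3 := h1.congr_of_eventuallyEq (f₁ := fun α : ℝ => ∫ τ : ℝ, (b τ * (τ : ℂ) ^ j) * (j.factorial * (4 * I) ^ j / (1 + 4 * I * τ * α) ^ (j + 1))) 
      (by filter_upwards [Ioi_mem_nhds hα] with a ha; exact (ih a ha).symm)
    exact neg_injective (h3.unique h2)

lemma fin_bin (w : ℂ) (hw : 1 + w ≠ 0) (l : ℕ) : 
   ∑ k ∈ Finset.range (l + 1), (l.choose k : ℂ) * ((-2 * w) ^ k / (1 + w) ^ (k + 1)) = (1 - w) ^ l / (1 + w) ^ (l + 1) := by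
  have h := add_pow (-2 * w / (1 + w)) 1 l
  have h2 : -2 * w / (1 + w) + 1 = (1 - w) / (1 + w) := by field_simp; ring
  rw [h2, div_pow] at h
  rw [pow_succ (1+w) l, ← div_div, h, Finset.sum_div]
  apply Finset.sum_congr rfl
  intro k hk
  rw [pow_succ, ← div_div, div_pow]
  simp
  ring

lemma stepA (F : SchwartzMap (V3 × V3) ℂ) (Φ B : SchwartzMap (ℝ × ℝ × ℝ) ℂ) 
   (hΦ : ∀ a b r lam : ℝ, ∫ p : V3 × V3, F p * cexp (I * ((a * p.1 0 + b * p.1 1 + r * p.1 2 + lam * p.2 2 : ℝ) : ℂ)) 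
      = Φ (a ^ 2 + b ^ 2 + r ^ 2, lam ^ 2, lam * r))
   (hB : ∀ t p, Φ (t, p) = ∫ τ : ℝ, B (τ, p) * cexp (-(I * ((τ * t : ℝ) : ℂ)))) (lam : ℝ) (hlam : 0 < lam) (l : ℕ) (r : ℝ) :
   ∫ p, F p * hfun lam l r p = ∫ τ : ℝ, B (τ,lam^2,lam*r) * (cexp (-(I*((τ*r^2:ℝ):ℂ))) * ((1-I*(lam*τ:ℝ))^l/(1+I*(lam*τ:ℝ))^(l+1))) := by
  let f : V3 × V3 → ℂ := fun p => F p * cexp (I * ((lam * p.2 2 + r * p.1 2 : ℝ) : ℂ))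
  let s : V3 × V3 → ℝ := fun p => p.1 0 ^ 2 + p.1 1 ^ 2
  let b : ℝ → ℂ := fun τ => B (τ, lam ^ 2, lam * r) * cexp (-(I * ((τ * r ^ 2 : ℝ) : ℂ)))
  have hs0 : ∀ x, 0 ≤ s x := fun x => by simp only [s]; positivity
  have hsc : Continuous s := by simp only [s]; fun_prop
  have hcoord : ∀ i : Fin 3, Function.HasTemperateGrowth (fun p : V3 × V3 => p.1 i) := by
    intro i
    exact ((ContinuousLinearMap.proj (R := ℝ) (φ := fun _ : Fin 3 => ℝ) i).comp (ContinuousLinearMap.fst ℝ V3 V3)).hasTemperateGrowth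
  have hst : ∀ j : ℕ, Function.HasTemperateGrowth (fun p : V3 × V3 => (s p : ℂ) ^ j) := by
    intro j
    have h1 : Function.HasTemperateGrowth s := ((hcoord 0).pow 2).add ((hcoord 1).pow 2)
    exact (tg_ofReal h1).pow j
  have hf : ∀ j : ℕ, Integrable (fun x => f x * (s x : ℂ) ^ j) := by
    intro j
    have h1 : Integrable (smulS (fun p : V3 × V3 => (s p : ℂ) ^ j) F : V3 × V3 → ℂ) := (smulS (fun p : V3 × V3 => (s p : ℂ) ^ j) F).integrable
    have h2 := h1.mul_bdd (g := fun p : V3 × V3 => cexp (I * ((lam * p.2 2 + r * p.1 2 : ℝ) : ℂ))) (c := 1) 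
      (by apply Continuous.aestronglyMeasurable; fun_prop) (Filter.Eventually.of_forall fun p => by rw [mul_comm I, Complex.norm_exp_ofReal_mul_I])
    refine h2.congr (Filter.Eventually.of_forall fun p => ?_)
    simp only [f, smulS_apply (hst j)]
    ring
  have hb : ∀ j : ℕ, Integrable (fun τ : ℝ => b τ * (τ : ℂ) ^ j) := by
    intro j
    have ht : Function.HasTemperateGrowth (fun τ : ℝ => (τ : ℂ) ^ j) := (tg_ofReal (ContinuousLinearMap.id ℝ ℝ).hasTemperateGrowth).pow j
    have h1 : Integrable (smulS (fun τ : ℝ => (τ : ℂ) ^ j) (sliceL B (lam ^ 2, lam * r)) : ℝ → ℂ) := (smulS (fun τ : ℝ => (τ : ℂ) ^ j) (sliceL B (lam ^ 2, lam * r))).integrable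
    have h2 := h1.mul_bdd (g := fun τ : ℝ => cexp (-(I * ((τ * r ^ 2 : ℝ) : ℂ)))) (c := 1) 
      (by apply Continuous.aestronglyMeasurable; fun_prop) (Filter.Eventually.of_forall fun p => by rw [norm_osc_exp])
    refine h2.congr (Filter.Eventually.of_forall fun p => ?_)
    simp only [b, smulS_apply ht]
    have : sliceL B (lam ^ 2, lam * r) p = B (p, lam ^ 2, lam * r) := rfl
    rw [this]
    ring
  have h0 : ∀ α : ℝ, 0 < α → ∫ x, f x * cexp (-((α * s x : ℝ) : ℂ)) = ∫ τ : ℝ, b τ * (1 / (1 + 4 * I * τ * α)) := by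
    intro α hα
    rw [← M0 F Φ B hΦ hB lam r α hα]
    congr 1
    ext p
    simp only [f, s]
    ring
  have key := fun j => MN volume f s hs0 hsc.aestronglyMeasurable hf b hb h0 j (lam / 4) (by positivity)
  have hd0 : ∀ τ : ℝ, (1 + I * (lam * τ : ℝ) : ℂ) ≠ 0 := by
    intro τ h
    have := norm_den (lam * τ)
    rw [h] at this; norm_num at this
  have e1 : ∀ p, F p * hfun lam l r p = ∑ k ∈ Finset.range (l + 1), ((l.choose k : ℂ) * (-(lam : ℂ) / 2) ^ k / k.factorial) * 
      ((f p * (s p : ℂ) ^ k) * cexp (-((lam / 4 * s p : ℝ) : ℂ))) := by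
    intro p
    simp only [hfun, lag_eq, f, s]
    push_cast
    rw [Finset.mul_sum, Finset.mul_sum]
    apply Finset.sum_congr rfl
    intro k hk
    rw [show -((lam : ℂ) / 2 * ((p.1 0 : ℂ) ^ 2 + (p.1 1 : ℂ) ^ 2) / 2) = -((lam : ℂ) / 4 * ((p.1 0 : ℂ) ^ 2 + (p.1 1 : ℂ) ^ 2)) by ring,
      show -((lam : ℂ) / 2 * ((p.1 0 : ℂ) ^ 2 + (p.1 1 : ℂ) ^ 2)) = (-(lam : ℂ) / 2) * ((p.1 0 : ℂ) ^ 2 + (p.1 1 : ℂ) ^ 2) by ring, mul_pow]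
    ring
  have e2 : ∀ τ : ℝ, B (τ,lam^2,lam*r) * (cexp (-(I*((τ*r^2:ℝ):ℂ))) * ((1-I*(lam*τ:ℝ))^l/(1+I*(lam*τ:ℝ))^(l+1))) = 
      ∑ k ∈ Finset.range (l + 1), ((l.choose k : ℂ) * (-(lam : ℂ) / 2) ^ k / k.factorial) * 
      ((b τ * (τ : ℂ) ^ k) * (k.factorial * (4 * I) ^ k / (1 + 4 * I * τ * (lam / 4 : ℝ)) ^ (k + 1))) := by
    intro τ
    rw [← fin_bin _ (hd0 τ), ← mul_assoc, Finset.mul_sum]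
    apply Finset.sum_congr rfl
    intro k hk
    have hk : (k.factorial : ℂ) ≠ 0 := by exact_mod_cast k.factorial_ne_zero
    rw [show (1 + 4 * I * τ * (lam / 4 : ℝ) : ℂ) = 1 + I * (lam * τ : ℝ) by push_cast; ring,
      show -2 * (I * ((lam * τ : ℝ) : ℂ)) = (-(lam : ℂ) / 2) * τ * (4 * I) by push_cast; ring, mul_pow, mul_pow]
    have := hd0 τ
    simp only [b]
    field_simp
  have hcN : ∀ k : ℕ, Integrable (fun τ : ℝ => (b τ * (τ : ℂ) ^ k) * (k.factorial * (4 * I) ^ k / (1 + 4 * I * τ * (lam / 4 : ℝ)) ^ (k + 1))) := by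
    intro k
    have hr : ∀ τ : ℝ, (1 + 4 * I * τ * (lam / 4 : ℝ) : ℂ) = 1 + I * (lam * τ : ℝ) := by intro τ; push_cast; ring
    simp only [hr]
    refine (hb k).mul_bdd (c := ‖(k.factorial * (4 * I) ^ k : ℂ)‖) ?_ (Filter.Eventually.of_forall fun τ => ?_)
    · apply Continuous.aestronglyMeasurable
      exact Continuous.div (by fun_prop) (by fun_prop) (fun τ => pow_ne_zero _ (hd0 τ))
    · rw [norm_div, norm_pow (1 + _)]
      exact div_le_self (norm_nonneg _) (one_le_pow₀ (norm_den _))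
  have hcM : ∀ k : ℕ, Integrable (fun p => (f p * (s p : ℂ) ^ k) * cexp (-((lam / 4 * s p : ℝ) : ℂ))) := by
    intro k
    refine (hf k).mul_bdd (c := 1) ?_ (Filter.Eventually.of_forall fun p => ?_)
    · apply Continuous.aestronglyMeasurable
      fun_prop
    · rw [← Complex.ofReal_neg, Complex.norm_exp_ofReal, Real.exp_le_one_iff]
      have := mul_nonneg (by positivity : 0 ≤ lam / 4) (hs0 p)
      linarith
  simp only [e1, e2]
  rw [integral_finsetSum _ (fun k _ => (hcM k).const_mul _), integral_finsetSum _ (fun k _ => (hcN k).const_mul _)]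
  apply Finset.sum_congr rfl
  intro k hk
  rw [integral_const_mul, integral_const_mul, key k]

lemma maxint (f : ℝ → ℂ) : ∫ a in Set.Ioo (-Real.pi) Real.pi, ((max (Real.sin a) 0 : ℝ) : ℂ) * f a = 
   ∫ a in (0:ℝ)..Real.pi, (Real.sin a : ℂ) * f a := by
  rw [intervalIntegral.integral_of_le Real.pi_pos.le, ← integral_Ioc_eq_integral_Ioo, ← integral_indicator measurableSet_Ioc, ← integral_indicator measurableSet_Ioc]
  congr 1
  ext a
  have hpi := Real.pi_pos
  by_cases h : a ∈ Set.Ioc 0 Real.pi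
  · have h' : a ∈ Set.Ioc (-Real.pi) Real.pi := ⟨by linarith [h.1], h.2⟩
    rw [Set.indicator_of_mem h, Set.indicator_of_mem h', max_eq_left (Real.sin_nonneg_of_nonneg_of_le_pi h.1.le h.2)]
  · rw [Set.indicator_of_notMem h]
    by_cases h' : a ∈ Set.Ioc (-Real.pi) Real.pi
    · rw [Set.indicator_of_mem h']
      have : a ≤ 0 := by by_contra h2; exact h ⟨not_le.mp h2, h'.2⟩
      rw [max_eq_right (Real.sin_nonpos_of_nonpos_of_neg_pi_le this h'.1.le)]
      simp
    · rw [Set.indicator_of_notMem h']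

lemma sinint (c : ℝ) : ∫ a in Set.Ioo (-Real.pi) Real.pi, ((max (Real.sin a) 0 : ℝ) : ℂ) * cexp (I * ((c * Real.cos a : ℝ) : ℂ)) = 
   2 * (Real.sinc c : ℂ) := by
  rw [maxint]
  by_cases hc : c = 0
  · subst hc
    have : ∀ a : ℝ, (Real.sin a : ℂ) * cexp (I * ((0 * Real.cos a : ℝ) : ℂ)) = ((Real.sin a : ℝ) : ℂ) := by intro a; simp
    simp only [this]
    rw [intervalIntegral.integral_ofReal, integral_sin]
    norm_num
  · have hc' : (c : ℂ) ≠ 0 := by exact_mod_cast hc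
    have hd : ∀ a ∈ Set.uIcc (0:ℝ) Real.pi, HasDerivAt (fun a : ℝ => - cexp (I * ((c * Real.cos a : ℝ) : ℂ)) / (I * c)) 
        ((Real.sin a : ℂ) * cexp (I * ((c * Real.cos a : ℝ) : ℂ))) a := by
      intro a _
      have h1 := ((((Real.hasDerivAt_cos a).const_mul c).ofReal_comp.const_mul I).cexp.neg.div_const (I * c))
      refine h1.congr_deriv ?_
      push_cast
      field_simp
    rw [intervalIntegral.integral_eq_sub_of_hasDerivAt hd (Continuous.intervalIntegrable (by fun_prop) _ _), Real.sinc_of_ne_zero hc]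
    simp only [Real.cos_pi, Real.cos_zero]
    push_cast
    rw [Complex.sin]
    rw [show I * ((c : ℂ) * -1) = -(c : ℂ) * I by ring, show I * ((c : ℂ) * 1) = (c : ℂ) * I by ring]
    field_simp
    rw [I_sq]
    ring

def ins3 : ℝ × ℝ →ₗ[ℝ] V3 where
  toFun q := ![q.2, 0, q.1]
  map_add' := by intro p q; ext i; fin_cases i <;> simp
  map_smul' := by intro p q; ext i; fin_cases i <;> simp

lemma ins3_inj : Function.Injective ins3 := by
  intro p q h
  have h0 := congrFun h 0
  have h2 := congrFun h 2
  simp [ins3] at h0 h2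
  exact Prod.ext h2 h0

lemma pull_lin {D : Type*} [NormedAddCommGroup D] [NormedSpace ℝ D] [FiniteDimensional ℝ D] (L : D →ₗ[ℝ] V3) (hL : Function.Injective L) 
    (ψ : SchwartzMap V3 ℂ) : ∃ χ : SchwartzMap D ℂ, ∀ q, χ q = ψ (L q) := by
  obtain ⟨K, hK, hK2⟩ := L.exists_antilipschitzWith (LinearMap.ker_eq_bot.mpr hL)
  have htg : (fun z => L z).HasTemperateGrowth := (LinearMap.toContinuousLinearMap L).hasTemperateGrowth
  exact ⟨SchwartzMap.compCLMOfAntilipschitz ℝ htg hK2 ψ, fun z => rfl⟩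

lemma v3_int (h : V3 → ℂ) (hh : Integrable h) : ∫ x, h x = ∫ z : ℝ, ∫ q : ℝ × ℝ, h ![q.1, q.2, z] := by
  have h1 := (volume_preserving_piFinSuccAbove (fun _ : Fin 3 => ℝ) 2).symm
  have h2 := (MeasurePreserving.id (volume : Measure ℝ)).prod (volume_preserving_finTwoArrow ℝ).symm
  have h3 := h1.comp h2
  have he : ∀ q : ℝ × ℝ × ℝ, ((MeasurableEquiv.piFinSuccAbove (fun _ : Fin 3 => ℝ) 2).symm ∘ (Prod.map id (MeasurableEquiv.finTwoArrow (α := ℝ)).symm)) q = 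
     ![q.2.1, q.2.2, q.1] := by
    intro q
    ext i
    fin_cases i <;> rfl
  have hemb : MeasurableEmbedding ((MeasurableEquiv.piFinSuccAbove (fun _ : Fin 3 => ℝ) 2).symm ∘ (Prod.map id (MeasurableEquiv.finTwoArrow (α := ℝ)).symm)) := 
    (MeasurableEquiv.measurableEmbedding _).comp (MeasurableEmbedding.id.prodMap (MeasurableEquiv.measurableEmbedding _))
  have h4 := h3.integral_comp hemb h
  have h5 := (h3.integrable_comp_emb hemb).mpr hh
  rw [← h4]
  simp only [Function.comp_def] at h5 he ⊢
  simp only [he] at h5 ⊢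
  exact integral_prod _ h5

lemma rad (ψ : SchwartzMap V3 ℂ) (hψ : ∀ k ∈ SO3, ∀ x, ψ (k.mulVec x) = ψ x) (E : ℝ × ℝ → ℂ) (hE : Continuous E) (hE1 : ∀ q, ‖E q‖ ≤ 1) : 
   ∫ x, ψ x * E (x 2, nrm3 x) = (∫ t in Set.Ioi (0:ℝ), ((t:ℂ)^2 * ψ ![0, 0, t]) * 
      ∫ a in Set.Ioo (-Real.pi) Real.pi, ((max (Real.sin a) 0 : ℝ) : ℂ) * E (t * Real.cos a, t)) * (2 * Real.pi) := by
  have hn : Continuous nrm3 := by unfold nrm3; fun_prop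
  have hi : Integrable (fun x => ψ x * E (x 2, nrm3 x)) := by
    refine ψ.integrable.mul_bdd (c := 1) ?_ (Filter.Eventually.of_forall fun x => hE1 _)
    apply Continuous.aestronglyMeasurable
    fun_prop
  rw [v3_int _ hi]
  have s1 : ∀ z : ℝ, ∫ q : ℝ × ℝ, ψ ![q.1, q.2, z] * E (![q.1, q.2, z] 2, nrm3 ![q.1, q.2, z]) = 
      (∫ ρ : ℝ, ((max ρ 0 : ℝ) : ℂ) * ψ ![ρ, 0, z] * E (z, √(z^2 + ρ^2))) * (2 * Real.pi) := by
    intro z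
    rw [← integral_comp_polarCoord_symm, polarCoord_target]
    have hpt : ∀ p ∈ Set.Ioi (0:ℝ) ×ˢ Set.Ioo (-Real.pi) Real.pi, 
       p.1 • (ψ ![(polarCoord.symm p).1, (polarCoord.symm p).2, z] * E (![(polarCoord.symm p).1, (polarCoord.symm p).2, z] 2, nrm3 ![(polarCoord.symm p).1, (polarCoord.symm p).2, z])) 
        = (((max p.1 0 : ℝ) : ℂ) * ψ ![p.1, 0, z] * E (z, √(z^2 + p.1^2))) * (fun _ => (1:ℂ)) p.2 := by
      intro p hp
      have hp1 : 0 < p.1 := hp.1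
      rw [polarCoord_symm_apply]
      have e1 : ![p.1 * Real.cos p.2, p.1 * Real.sin p.2, z] = (rot01 (-p.2)).mulVec ![p.1, 0, z] := by
        ext i
        fin_cases i <;> simp [rot01, Matrix.mulVec, dotProduct, Fin.sum_univ_three] <;> ring
      have e2 : nrm3 ![p.1 * Real.cos p.2, p.1 * Real.sin p.2, z] = √(z^2 + p.1^2) := by
        simp only [nrm3]
        congr 1
        simp
        linear_combination p.1^2 * Real.sin_sq_add_cos_sq p.2
      have e0 : ψ ![p.1 * Real.cos p.2, p.1 * Real.sin p.2, z] = ψ ![p.1, 0, z] := by rw [e1, hψ _ (rot01_mem _)]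
      simp only
      rw [e2, e0, max_eq_left hp1.le]
      simp
      ring
    rw [setIntegral_congr_fun (measurableSet_Ioi.prod measurableSet_Ioo) hpt]
    have := setIntegral_prod_mul (μ := (volume : Measure ℝ)) (ν := (volume : Measure ℝ)) (fun ρ : ℝ => (((max ρ 0 : ℝ) : ℂ) * ψ ![ρ, 0, z] * E (z, √(z^2 + ρ^2)))) (fun _ : ℝ => (1:ℂ)) (Set.Ioi 0) (Set.Ioo (-Real.pi) Real.pi)
    refine this.trans ?_
    congr 1
    · rw [← integral_indicator measurableSet_Ioi]
      congr 1
      ext ρ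
      by_cases h : ρ ∈ Set.Ioi (0:ℝ)
      · rw [Set.indicator_of_mem h]
      · rw [Set.indicator_of_notMem h, max_eq_right (not_lt.mp h)]; simp
    · simp [Real.pi_pos.le]
      ring
  simp only [s1]
  rw [integral_mul_const]
  congr 1
  obtain ⟨χ, hχ⟩ := pull_lin ins3 ins3_inj ψ
  have hi2 : Integrable (fun q : ℝ × ℝ => ((max q.2 0 : ℝ) : ℂ) * ψ ![q.2, 0, q.1] * E (q.1, √(q.1^2 + q.2^2))) := by
    have ht : Function.HasTemperateGrowth (fun q : ℝ × ℝ => (q.2 : ℂ)) := tg_ofReal tg_snd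
    have h1 : Integrable (smulS (fun q : ℝ × ℝ => (q.2 : ℂ)) χ : ℝ × ℝ → ℂ) := (smulS (fun q : ℝ × ℝ => (q.2 : ℂ)) χ).integrable
    have hc : Continuous (fun q : ℝ × ℝ => ψ ![q.2, 0, q.1]) := ψ.continuous.comp (LinearMap.continuous_of_finiteDimensional ins3)
    refine h1.mono (by apply Continuous.aestronglyMeasurable; fun_prop) (Filter.Eventually.of_forall fun q => ?_)
    rw [smulS_apply ht, hχ]
    rw [norm_mul]
    refine (mul_le_of_le_one_right (norm_nonneg _) (hE1 _)).trans ?_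
    rw [norm_mul, norm_mul]
    refine mul_le_mul_of_nonneg_right ?_ (norm_nonneg _)
    rw [Complex.norm_real, Complex.norm_real, Real.norm_eq_abs, Real.norm_eq_abs, abs_of_nonneg (le_max_right _ _)]
    exact max_le (le_abs_self _) (abs_nonneg _)
  rw [← integral_prod _ hi2, ← Measure.volume_eq_prod, ← integral_comp_polarCoord_symm, polarCoord_target]
  let L1 : ℝ →ₗ[ℝ] V3 := LinearMap.single ℝ (fun _ : Fin 3 => ℝ) 2
  have hL1 : ∀ t, L1 t = ![0, 0, t] := by
    intro t; ext i; fin_cases i <;> simp [L1]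
  obtain ⟨χ1, hχ1⟩ := pull_lin L1 (fun a b h => by have := congrFun h 2; rw [hL1, hL1] at this; simpa using this) ψ
  simp only [hL1] at hχ1
  have hpt : ∀ p ∈ Set.Ioi (0:ℝ) ×ˢ Set.Ioo (-Real.pi) Real.pi, 
     p.1 • (((max (polarCoord.symm p).2 0 : ℝ) : ℂ) * ψ ![(polarCoord.symm p).2, 0, (polarCoord.symm p).1] * E ((polarCoord.symm p).1, √((polarCoord.symm p).1^2 + (polarCoord.symm p).2^2)))
      = ((p.1:ℂ)^2 * χ1 p.1) * (((max (Real.sin p.2) 0 : ℝ) : ℂ) * E (p.1 * Real.cos p.2, p.1)) := by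
    intro p hp
    have hp1 : 0 < p.1 := hp.1
    rw [polarCoord_symm_apply]
    have e1 : ![p.1 * Real.sin p.2, 0, p.1 * Real.cos p.2] = (rot02 (p.2)).mulVec ![0, 0, p.1] := by
      ext i
      fin_cases i <;> simp [rot02, Matrix.mulVec, dotProduct, Fin.sum_univ_three] <;> ring
    have e2 : √((p.1 * Real.cos p.2)^2 + (p.1 * Real.sin p.2)^2) = p.1 := by
      rw [show (p.1 * Real.cos p.2)^2 + (p.1 * Real.sin p.2)^2 = p.1^2 by linear_combination p.1^2 * Real.sin_sq_add_cos_sq p.2]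
      exact Real.sqrt_sq hp1.le
    have e3 : max (p.1 * Real.sin p.2) 0 = p.1 * max (Real.sin p.2) 0 := by
      rw [mul_max_of_nonneg _ _ hp1.le, mul_zero]
    simp only
    rw [e2, e1, hψ _ (rot02_mem _), e3, hχ1, Complex.real_smul]
    push_cast
    ring
  rw [setIntegral_congr_fun (measurableSet_Ioi.prod measurableSet_Ioo) hpt]
  simp only [← hχ1, ← integral_const_mul]
  rw [Measure.volume_eq_prod]
  refine setIntegral_prod _ ?_
  have ht : Function.HasTemperateGrowth (fun t : ℝ => (t : ℂ) ^ 2) := (tg_ofReal (ContinuousLinearMap.id ℝ ℝ).hasTemperateGrowth).pow 2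
  have h1 : Integrable (fun t : ℝ => (t:ℂ)^2 * χ1 t) := by
    have : Integrable (smulS (fun t : ℝ => (t : ℂ)^2) χ1 : ℝ → ℂ) := (smulS (fun t : ℝ => (t : ℂ)^2) χ1).integrable
    exact this.congr (Filter.Eventually.of_forall fun t => by rw [smulS_apply ht])
  have h2 : IntegrableOn (fun a : ℝ => (1:ℂ)) (Set.Ioo (-Real.pi) Real.pi) := by
    simp
  have h3 := h1.integrableOn (s := Set.Ioi 0) |>.mul_prod h2
  unfold IntegrableOn
  rw [← Measure.prod_restrict]
  have h4 := h3.mul_bdd (g := fun p : ℝ × ℝ => ((max (Real.sin p.2) 0 : ℝ) : ℂ) * E (p.1 * Real.cos p.2, p.1)) (c := 1) 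
    (by apply Continuous.aestronglyMeasurable; fun_prop) (Filter.Eventually.of_forall fun p => by
      rw [norm_mul, Complex.norm_real, Real.norm_eq_abs, abs_of_nonneg (le_max_right _ _)]
      exact mul_le_one₀ (max_le (Real.sin_le_one _) zero_le_one) (norm_nonneg _) (hE1 _))
  simpa using h4

lemma stepB (F : SchwartzMap (V3 × V3) ℂ) (hF : Inv3 F) (R : ℝ) : 
   ∫ p : V3 × V3, F p * cexp (I * ((R * p.1 2 : ℝ) : ℂ)) = ∫ p : V3 × V3, F p * (sph0 R p.1 : ℂ) := by
  let sw : SchwartzMap (V3 × V3) ℂ := SchwartzMap.compCLMOfContinuousLinearEquiv ℝ (ContinuousLinearEquiv.prodComm ℝ V3 V3) F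
  have hsw : ∀ x y, sw (x, y) = F (y, x) := fun x y => rfl
  obtain ⟨ψ, hψ⟩ := pint (volume : Measure V3) sw
  simp only [hsw] at hψ
  have hinv : ∀ k ∈ SO3, ∀ x, ψ (k.mulVec x) = ψ x := by
    intro k hk x
    rw [hψ, hψ]
    have hu : IsUnit k := by rw [Matrix.isUnit_iff_isUnit_det, hk.2]; exact isUnit_one
    have hinj := Matrix.mulVec_injective_of_isUnit hu
    have h1 : MeasurePreserving (fun x : V3 => k.mulVec x) := by
      refine ⟨by fun_prop, ?_⟩
      have h := Real.map_matrix_volume_pi_eq_smul_volume_pi (M := k) (by rw [hk.2]; exact one_ne_zero)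
      rw [hk.2] at h
      simp at h
      exact h
    rw [← h1.integral_comp (Continuous.measurableEmbedding (by fun_prop) hinj)]
    congr 1
    ext y
    exact hF k hk x y
  have hn : Continuous nrm3 := by unfold nrm3; fun_prop
  have red : ∀ E : ℝ × ℝ → ℂ, Continuous E → (∀ q, ‖E q‖ ≤ 1) → ∫ p : V3 × V3, F p * E (p.1 2, nrm3 p.1) = ∫ x, ψ x * E (x 2, nrm3 x) := by
    intro E hE hE1
    have hi : Integrable (fun p : V3 × V3 => F p * E (p.1 2, nrm3 p.1)) := by
      refine F.integrable.mul_bdd (c := 1) ?_ (Filter.Eventually.of_forall fun x => hE1 _)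
      apply Continuous.aestronglyMeasurable
      fun_prop
    rw [Measure.volume_eq_prod, integral_prod _ hi]
    congr 1
    ext x
    simp only
    rw [integral_mul_const, hψ]
  have hs : ∀ p : V3 × V3, (sph0 R p.1 : ℂ) = (fun q : ℝ × ℝ => (Real.sinc (R * q.2) : ℂ)) (p.1 2, nrm3 p.1) := by
    intro p
    simp only [sph0, Real.sinc_apply]
  have hexp : ∀ p : V3 × V3, cexp (I * ((R * p.1 2 : ℝ) : ℂ)) = (fun q : ℝ × ℝ => cexp (I * ((R * q.1 : ℝ) : ℂ))) (p.1 2, nrm3 p.1) := fun p => rfl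
  have c1 : Continuous (fun q : ℝ × ℝ => (Real.sinc (R * q.2) : ℂ)) := 
    Complex.continuous_ofReal.comp (Real.continuous_sinc.comp (by fun_prop))
  have b1 : ∀ q : ℝ × ℝ, ‖(Real.sinc (R * q.2) : ℂ)‖ ≤ 1 := fun q => by 
    rw [Complex.norm_real]; exact Real.abs_sinc_le_one _
  have c2 : Continuous (fun q : ℝ × ℝ => cexp (I * ((R * q.1 : ℝ) : ℂ))) := by fun_prop
  have b2 : ∀ q : ℝ × ℝ, ‖cexp (I * ((R * q.1 : ℝ) : ℂ))‖ ≤ 1 := fun q => by 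
    rw [mul_comm I, Complex.norm_exp_ofReal_mul_I]
  have hR : ∫ p : V3 × V3, F p * (sph0 R p.1 : ℂ) = ∫ x, ψ x * (fun q : ℝ × ℝ => (Real.sinc (R * q.2) : ℂ)) (x 2, nrm3 x) := by
    rw [← red _ c1 b1]
    congr 1
  rw [hR]
  refine (red _ c2 b2).trans ?_
  rw [ rad ψ hinv _ c1 b1, rad ψ hinv _ c2 b2]
  congr 2
  ext t
  congr 1
  simp only
  rw [integral_mul_const]
  have h0 := sinint 0
  have h1 := sinint (R * t)
  simp only [zero_mul, Complex.ofReal_zero, mul_zero, Complex.exp_zero, mul_one, Real.sinc_zero, Complex.ofReal_one] at h0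
  rw [h0]
  simp only [← mul_assoc]
  exact h1

/-- The Gelfand transform of any Schwartz `SO(3)`-invariant function on `N_{3,2}` admits a
Schwartz extension to `ℝ³`. -/
theorem statement0 (μ : Measure Mat3) (hμ : IsHaarSO3 μ)
    (F : SchwartzMap (V3 × V3) ℂ) (hF : Inv3 ⇑F) :
    ∃ f : SchwartzMap (ℝ × ℝ × ℝ) ℂ,
      (∀ lam > (0:ℝ), ∀ l : ℕ, ∀ r : ℝ,
        f (lam * (2 * l + 1) + r ^ 2, lam ^ 2, lam * r)
          = ∫ p : V3 × V3, F p * (starRingEnd ℂ) (sph μ lam l r p.1 p.2)) ∧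
      (∀ R ≥ (0:ℝ), f (R ^ 2, 0, 0) = ∫ p : V3 × V3, F p * (sph0 R p.1 : ℂ)) := by
  obtain ⟨Φ, hΦ⟩ := stepPhi F hF
  obtain ⟨B, f, hB, hfa, hfb⟩ := stepf Φ
  refine ⟨f, fun lam hlam l r => ?_, fun R hR => ?_⟩
  · rw [redA μ hμ F hF lam hlam l r, stepA F Φ B hΦ hB lam hlam l r]
    exact hfa lam l r
  · rw [hfb, ← stepB F hF R]
    have h := hΦ 0 0 R 0
    simp only [zero_mul, zero_add, add_zero, ne_eq, OfNat.ofNat_ne_zero, not_false_eq_true, zero_pow] at h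
    exact h.symm
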